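/- arXiv:2305.06065 — 15 statements merged into one kernel-verified Lean document; each statement's English description precedes it below -/
import Mathlib

section
/- Let a > b > 0 and let A = (X,Y) ∈ ℝ². If (a²X²)^(1/3) + (b²Y²)^(1/3) < ((a²−b²)²)^(1/3) (A lies strictly inside the astroid), then n(A) = 4; if (a²X²)^(1/3) + (b²Y²)^(1/3) > ((a²−b²)²)^(1/3) (A lies strictly outside the astroid), then n(A) = 2. -/
/-- The feet of normals of an ellipse, rescaled to the unit circle. -/
def circleFeet (p q : ℝ) : Set (ℝ × ℝ) :=
  {z | z.1 ^ 2 + z.2 ^ 2 = 1 ∧ p * z.2 - q * z.1 = z.1 * z.2}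

/-- The quartic satisfied by the abscissas of the points of `circleFeet p q`. -/
def feetQuartic (p q c : ℝ) : ℝ := (c ^ 2 - 1) * (c - p) ^ 2 + q ^ 2 * c ^ 2

theorem ncard_circleFeet_neg_left (p q : ℝ) :
    (circleFeet (-p) q).ncard = (circleFeet p q).ncard := by
  refine Set.ncard_congr (fun z _ => (-z.1, z.2)) ?_ ?_ ?_
  · rintro ⟨c, s⟩ ⟨h₁, h₂⟩
    simp only [circleFeet, Set.mem_ofPred_eq] at h₁ h₂ ⊢
    constructor <;> linarith
  · rintro ⟨c, s⟩ ⟨c', s'⟩ _ _ h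
    simpa using h
  · rintro ⟨c, s⟩ ⟨h₁, h₂⟩
    simp only at h₁ h₂
    exact ⟨(-c, s), ⟨by simp only; linarith, by simp only; linarith⟩, by simp⟩

theorem ncard_circleFeet_swap (p q : ℝ) :
    (circleFeet (-q) (-p)).ncard = (circleFeet p q).ncard := by
  refine Set.ncard_congr (fun z _ => (z.2, z.1)) ?_ ?_ ?_
  · rintro ⟨c, s⟩ ⟨h₁, h₂⟩
    simp only [circleFeet, Set.mem_ofPred_eq] at h₁ h₂ ⊢
    constructor <;> linarith
  · rintro ⟨c, s⟩ ⟨c', s'⟩ _ _ h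
    simp only [Prod.mk.injEq] at h ⊢
    exact h.symm
  · rintro ⟨c, s⟩ ⟨h₁, h₂⟩
    simp only at h₁ h₂
    exact ⟨(s, c), ⟨by simp only; linarith, by simp only; linarith⟩, rfl⟩

theorem ncard_circleFeet_neg_right (p q : ℝ) :
    (circleFeet p (-q)).ncard = (circleFeet p q).ncard :=
  (ncard_circleFeet_swap p (-q)).symm.trans
    ((ncard_circleFeet_neg_left (-q) (-p)).trans (ncard_circleFeet_swap p q))

theorem ncard_circleFeet_abs (p q : ℝ) :
    (circleFeet |p| |q|).ncard = (circleFeet p q).ncard := by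
  rcases abs_choice p with hp | hp <;> rcases abs_choice q with hq | hq <;>
    simp only [hp, hq, ncard_circleFeet_neg_left, ncard_circleFeet_neg_right]

theorem ncard_circleFeet_eq_ncard_quartic {p q : ℝ} (hp : 0 < p) (hq : 0 < q) :
    (circleFeet p q).ncard = {c | feetQuartic p q c = 0}.ncard := by
  refine Set.ncard_congr (fun z _ => z.1) ?_ ?_ ?_
  · rintro ⟨c, s⟩ ⟨h₁, h₂⟩
    simp only [feetQuartic, Set.mem_ofPred_eq] at h₁ h₂ ⊢
    have h : s * (p - c) = q * c := by linarith
    have : c ^ 2 - 1 = -s ^ 2 := by linarith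
    rw [this]
    linear_combination (-(s * (p - c)) - q * c) * h
  · rintro ⟨c, s⟩ ⟨c', s'⟩ ⟨_, h₂⟩ ⟨_, h₂'⟩ h
    simp only at h h₂ h₂'
    subst h
    have hc : p - c ≠ 0 := by
      intro h
      obtain rfl : p = c := by linarith
      have : 0 < q * p := by positivity
      linarith
    have : s * (p - c) = s' * (p - c) := by linarith
    rw [mul_right_cancel₀ hc this]
  · intro c h
    simp only [feetQuartic, Set.mem_ofPred_eq] at h
    have hc : p - c ≠ 0 := by
      intro h'
      obtain rfl : p = c := by linarith
      have : 0 < q ^ 2 * p ^ 2 := by positivity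
      simp at h
      grind
    refine ⟨(c, q * c / (p - c)), ⟨?_, ?_⟩, rfl⟩ <;> simp only <;> field_simp <;> linarith

theorem feetQuartic_self (p q : ℝ) : feetQuartic p q p = q ^ 2 * p ^ 2 := by
  simp [feetQuartic]

theorem continuous_feetQuartic (p q : ℝ) : Continuous (feetQuartic p q) := by
  unfold feetQuartic
  fun_prop

theorem exists_feetQuartic_root_neg {p q : ℝ} (hp : 0 < p) (hq : 0 < q) :
    ∃ c ∈ Set.Ioo (-1) 0, feetQuartic p q c = 0 := by
  refine intermediate_value_Ioo' (by norm_num) (continuous_feetQuartic p q).continuousOn ⟨?_, ?_⟩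
  · simp only [feetQuartic]; nlinarith [pow_pos hp 2]
  · simp only [feetQuartic]; nlinarith [pow_pos hq 2]

theorem exists_feetQuartic_root_pos {p q : ℝ} (hp : 0 < p) (hq : 0 < q) :
    ∃ c ∈ Set.Ioo 0 p, feetQuartic p q c = 0 := by
  refine intermediate_value_Ioo hp.le (continuous_feetQuartic p q).continuousOn ⟨?_, ?_⟩
  · simp only [feetQuartic]; nlinarith [pow_pos hp 2]
  · rw [feetQuartic_self]; positivity

theorem feetQuartic_finite_ncard_le (p q : ℝ) :
    {c | feetQuartic p q c = 0}.Finite ∧ {c | feetQuartic p q c = 0}.ncard ≤ 4 := by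
  open Polynomial in
  let P : ℝ[X] := (X ^ 2 - 1) * (X - C p) ^ 2 + C (q ^ 2) * X ^ 2
  have hdeg : P.natDegree = 4 := by
    unfold P
    compute_degree!
  have hP : P ≠ 0 := by
    rintro h
    simp [h] at hdeg
  have h : {c | feetQuartic p q c = 0} = (P.roots.toFinset : Set ℝ) := by
    ext c
    rw [Finset.mem_coe, Multiset.mem_toFinset, Polynomial.mem_roots hP]
    simp [P, feetQuartic]
  rw [h, Set.ncard_coe_finset]
  exact ⟨Finset.finite_toSet _,
    (Multiset.toFinset_card_le _).trans ((Polynomial.card_roots' P).trans hdeg.le)⟩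

theorem ncard_circleFeet_inside_pos {u v : ℝ} (hu : 0 < u) (hv : 0 < v) (h : u ^ 2 + v ^ 2 < 1) :
    (circleFeet (u ^ 3) (v ^ 3)).ncard = 4 := by
  have hp : 0 < u ^ 3 := by positivity
  have hq : 0 < v ^ 3 := by positivity
  rw [ncard_circleFeet_eq_ncard_quartic hp hq]
  obtain ⟨hfin, hle⟩ := feetQuartic_finite_ncard_le (u ^ 3) (v ^ 3)
  refine le_antisymm hle ?_
  set r := √(u ^ 2 + v ^ 2)
  have hr : 0 < r := by positivity
  have hr2 : r ^ 2 = u ^ 2 + v ^ 2 := Real.sq_sqrt (by positivity)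
  have hr1 : r < 1 := by nlinarith
  have hmid : feetQuartic (u ^ 3) (v ^ 3) (u / r) < 0 := by
    have hv2 : v ^ 2 = r ^ 2 - u ^ 2 := by linarith
    have : feetQuartic (u ^ 3) (v ^ 3) (u / r) =
        -(u ^ 2 * v ^ 2 / r ^ 4) * (1 - r ^ 3) * (1 + r ^ 3 - 2 * r * u ^ 2) := by
      have hv6 : (v ^ 3) ^ 2 = (r ^ 2 - u ^ 2) ^ 3 := by rw [← hv2]; ring
      rw [feetQuartic, hv6, hv2]
      field_simp
      ring
    have h₁ : 0 < 1 - r ^ 3 := by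
      have := pow_lt_one₀ hr.le hr1 (n := 3) (by norm_num)
      linarith
    have h₂ : 0 < 1 + r ^ 3 - 2 * r * u ^ 2 := by
      nlinarith [mul_pos hr (pow_pos hv 2), mul_pos hr (pow_pos hu 2)]
    rw [this, neg_mul, neg_mul]
    have := mul_pos (mul_pos (show 0 < u ^ 2 * v ^ 2 / r ^ 4 by positivity) h₁) h₂
    linarith
  have hpr : u ^ 3 < u / r := by
    rw [lt_div_iff₀ hr]
    have : u ^ 2 * r < 1 := by nlinarith [pow_pos hu 2, pow_pos hv 2]
    nlinarith
  have hr' : u / r < 1 := by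
    rw [div_lt_one hr]
    nlinarith [pow_pos hv 2]
  obtain ⟨c₁, ⟨_, h₁⟩, e₁⟩ := exists_feetQuartic_root_neg hp hq
  obtain ⟨c₂, ⟨h₂, h₂'⟩, e₂⟩ := exists_feetQuartic_root_pos hp hq
  obtain ⟨c₃, ⟨h₃, h₃'⟩, e₃⟩ := intermediate_value_Ioo' hpr.le
    (continuous_feetQuartic (u ^ 3) (v ^ 3)).continuousOn
    ⟨hmid, by rw [feetQuartic_self]; positivity⟩
  obtain ⟨c₄, ⟨h₄, _⟩, e₄⟩ := intermediate_value_Ioo hr'.le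
    (continuous_feetQuartic (u ^ 3) (v ^ 3)).continuousOn
    ⟨hmid, show 0 < feetQuartic (u ^ 3) (v ^ 3) 1 by
      simp only [feetQuartic, one_pow, sub_self, zero_mul]; positivity⟩
  have hsub : (({c₁, c₂, c₃, c₄} : Finset ℝ) : Set ℝ) ⊆
      {c | feetQuartic (u ^ 3) (v ^ 3) c = 0} := by
    intro c hc
    simp only [Finset.coe_insert, Finset.coe_singleton, Set.mem_insert_iff,
      Set.mem_singleton_iff] at hc
    rcases hc with rfl | rfl | rfl | rfl <;> assumption
  have hcard : ({c₁, c₂, c₃, c₄} : Finset ℝ).card = 4 := by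
    have h₁₂ : c₁ < c₂ := by linarith
    have h₂₃ : c₂ < c₃ := by linarith
    have h₃₄ : c₃ < c₄ := by linarith
    simp [h₁₂.ne, h₂₃.ne, h₃₄.ne, (h₁₂.trans h₂₃).ne, (h₂₃.trans h₃₄).ne,
      (h₁₂.trans (h₂₃.trans h₃₄)).ne]
  rw [← hcard, ← Set.ncard_coe_finset]
  exact Set.ncard_le_ncard hsub hfin

theorem feetQuartic_root_unique {p q c c' : ℝ} (hp : 0 < p) (hq : 0 < q)
    (h : feetQuartic p q c = 0) (h' : feetQuartic p q c' = 0) (hcp : c < p) (hcp' : c' < p)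
    (hcc : 0 < c * c') : c = c' := by
  by_contra hne
  wlog hlt : c < c' generalizing c c'
  · exact this h' h hcp' hcp (by linarith) (Ne.symm hne) (lt_of_le_of_ne (not_lt.1 hlt) (Ne.symm hne))
  have key : ∀ {c : ℝ}, c < p → feetQuartic p q c = 0 → c ^ 2 + (q * c / (p - c)) ^ 2 = 1 := by
    intro c hc h
    have : p - c ≠ 0 := by linarith
    simp only [feetQuartic] at h
    field_simp
    linarith
  have e := key hcp h
  have e' := key hcp' h'
  have hs : q * c / (p - c) < q * c' / (p - c') := by
    rw [div_lt_div_iff₀ (by linarith) (by linarith)]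
    nlinarith [mul_pos hp (mul_pos hq (sub_pos.2 hlt))]
  rcases lt_or_ge 0 c with hc | hc
  · have : 0 < q * c / (p - c) := div_pos (by positivity) (by linarith)
    nlinarith
  · have hc' : c' < 0 := by
      by_contra hc'
      nlinarith
    have : q * c' / (p - c') < 0 := div_neg_of_neg_of_pos (by nlinarith) (by linarith)
    nlinarith

theorem ncard_circleFeet_outside_pos {u v : ℝ} (hu : 0 < u) (hv : 0 < v)
    (h : 1 < u ^ 2 + v ^ 2) : (circleFeet (u ^ 3) (v ^ 3)).ncard = 2 := by
  have hp : 0 < u ^ 3 := by positivity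
  have hq : 0 < v ^ 3 := by positivity
  rw [ncard_circleFeet_eq_ncard_quartic hp hq]
  obtain ⟨c₁, ⟨h₁', h₁⟩, e₁⟩ := exists_feetQuartic_root_neg hp hq
  obtain ⟨c₂, ⟨h₂, h₂'⟩, e₂⟩ := exists_feetQuartic_root_pos hp hq
  have hlt : ∀ c, feetQuartic (u ^ 3) (v ^ 3) c = 0 → c < u ^ 3 := by
    intro c hc
    by_contra! hpc
    have hc0 : 0 < c := by linarith
    have hpc : u ^ 3 < c := by
      refine lt_of_le_of_ne hpc ?_
      rintro rfl
      have : 0 < (v ^ 3) ^ 2 * (u ^ 3) ^ 2 := by positivity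
      rw [feetQuartic_self] at hc
      linarith
    set s := v ^ 3 * c / (c - u ^ 3) with hs_def
    have hcs : 0 < c - u ^ 3 := by linarith
    have hs : 0 < s := by positivity
    have hs' : s * (c - u ^ 3) = v ^ 3 * c := by rw [hs_def]; field_simp
    have hunit : c ^ 2 + s ^ 2 = 1 := by
      rw [hs_def]
      simp only [feetQuartic] at hc
      field_simp
      linarith
    have hcauchy : (u ^ 2 + v ^ 2) ^ 2 ≤ u * c + v * s := by
      have : (u ^ 3 * s + v ^ 3 * c) * (u * c + v * s) - (u ^ 2 + v ^ 2) ^ 2 * (c * s) =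
          u * v * (u * s - v * c) ^ 2 := by ring
      have hcs' : u ^ 3 * s + v ^ 3 * c = c * s := by linarith
      rw [hcs'] at this
      have h0 : 0 ≤ u * v * (u * s - v * c) ^ 2 := by positivity
      refine le_of_mul_le_mul_left ?_ (mul_pos hc0 hs)
      linarith
    have hsq : (u * c + v * s) ^ 2 ≤ u ^ 2 + v ^ 2 := by
      have : (u * c + v * s) ^ 2 + (u * s - v * c) ^ 2 = (u ^ 2 + v ^ 2) * (c ^ 2 + s ^ 2) := by ring
      rw [hunit] at this
      nlinarith [sq_nonneg (u * s - v * c)]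
    have hlt : u ^ 2 + v ^ 2 < u * c + v * s := by nlinarith
    nlinarith
  have : {c | feetQuartic (u ^ 3) (v ^ 3) c = 0} = {c₁, c₂} := by
    ext c
    simp only [Set.mem_ofPred_eq, Set.mem_insert_iff, Set.mem_singleton_iff]
    refine ⟨fun hc => ?_, ?_⟩
    · rcases lt_trichotomy c 0 with h0 | rfl | h0
      · exact .inl (feetQuartic_root_unique hp hq hc e₁ (hlt c hc) (hlt c₁ e₁)
          (mul_pos_of_neg_of_neg h0 h₁))
      · simp only [feetQuartic] at hc
        nlinarith [pow_pos hp 2]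
      · exact .inr (feetQuartic_root_unique hp hq hc e₂ (hlt c hc) h₂' (mul_pos h0 h₂))
    · rintro (rfl | rfl) <;> assumption
  rw [this, Set.ncard_pair (by linarith)]

theorem circleFeet_zero_left (q : ℝ) :
    circleFeet 0 q = {z | z.1 = 0 ∧ z.2 ^ 2 = 1} ∪ {z | z.1 ^ 2 = 1 - q ^ 2 ∧ z.2 = -q} := by
  ext ⟨c, s⟩
  simp only [circleFeet, Set.mem_ofPred_eq, Set.mem_union]
  constructor
  · rintro ⟨h₁, h₂⟩
    have : c * (s + q) = 0 := by linarith
    rcases mul_eq_zero.1 this with rfl | h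
    · left; constructor <;> linarith
    · obtain rfl : s = -q := by linarith
      right; constructor <;> linarith
  · rintro (⟨rfl, h⟩ | ⟨h, rfl⟩) <;> constructor <;> linarith

theorem ncard_circleFeet_zero_left_inside {q : ℝ} (hq : q ^ 2 < 1) :
    (circleFeet 0 q).ncard = 4 := by
  have ht : 0 < √(1 - q ^ 2) := Real.sqrt_pos.2 (by linarith)
  have ht2 : √(1 - q ^ 2) ^ 2 = 1 - q ^ 2 := Real.sq_sqrt (by linarith)
  set t := √(1 - q ^ 2)
  have : circleFeet 0 q = (({(0, 1), (0, -1), (t, -q), (-t, -q)} : Finset (ℝ × ℝ)) :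
      Set (ℝ × ℝ)) := by
    rw [circleFeet_zero_left, ← ht2]
    ext ⟨c, s⟩
    simp [sq_eq_sq_iff_eq_or_eq_neg]
    tauto
  rw [this, Set.ncard_coe_finset]
  have h2 : t ≠ -t := by linarith
  have h3 : t ≠ 0 := ht.ne'
  have h4 : (1 : ℝ) ≠ -1 := by norm_num
  rw [Finset.card_insert_of_notMem (by simp [h3, h3.symm, h4]),
    Finset.card_insert_of_notMem (by simp [h3, h3.symm]),
    Finset.card_insert_of_notMem (by simp [h2]), Finset.card_singleton]

theorem ncard_circleFeet_zero_left_outside {q : ℝ} (hq : 1 < q ^ 2) :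
    (circleFeet 0 q).ncard = 2 := by
  have : circleFeet 0 q = {(0, 1), (0, -1)} := by
    rw [circleFeet_zero_left]
    ext ⟨c, s⟩
    have : c ^ 2 ≠ 1 - q ^ 2 := by nlinarith [sq_nonneg c]
    simp [this]
    tauto
  rw [this, Set.ncard_pair]
  norm_num

theorem ncard_circleFeet_inside {u v : ℝ} (hu : 0 ≤ u) (hv : 0 ≤ v) (h : u ^ 2 + v ^ 2 < 1) :
    (circleFeet (u ^ 3) (v ^ 3)).ncard = 4 := by
  have aux : ∀ {w : ℝ}, w ^ 2 < 1 → (w ^ 3) ^ 2 < 1 := fun {w} hw => by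
    have := pow_lt_one₀ (sq_nonneg w) hw (n := 3) (by norm_num)
    linarith [show (w ^ 3) ^ 2 = (w ^ 2) ^ 3 by ring]
  rcases hu.eq_or_lt with rfl | hu
  · rw [zero_pow (by norm_num)]
    exact ncard_circleFeet_zero_left_inside (aux (by linarith))
  rcases hv.eq_or_lt with rfl | hv
  · rw [zero_pow (by norm_num), ← ncard_circleFeet_swap, neg_zero]
    exact ncard_circleFeet_zero_left_inside (by rw [neg_sq]; exact aux (by linarith))
  exact ncard_circleFeet_inside_pos hu hv h

theorem ncard_circleFeet_outside {u v : ℝ} (hu : 0 ≤ u) (hv : 0 ≤ v) (h : 1 < u ^ 2 + v ^ 2) :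
    (circleFeet (u ^ 3) (v ^ 3)).ncard = 2 := by
  have aux : ∀ {w : ℝ}, 1 < w ^ 2 → 1 < (w ^ 3) ^ 2 := fun {w} hw => by
    have := one_lt_pow₀ hw (n := 3) (by norm_num)
    linarith [show (w ^ 3) ^ 2 = (w ^ 2) ^ 3 by ring]
  rcases hu.eq_or_lt with rfl | hu
  · rw [zero_pow (by norm_num)]
    exact ncard_circleFeet_zero_left_outside (aux (by linarith))
  rcases hv.eq_or_lt with rfl | hv
  · rw [zero_pow (by norm_num), ← ncard_circleFeet_swap, neg_zero]
    exact ncard_circleFeet_zero_left_outside (by rw [neg_sq]; exact aux (by linarith))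
  exact ncard_circleFeet_outside_pos hu hv h

theorem ncard_feet_eq_ncard_circleFeet {a b : ℝ} (hab : a > b) (hb : b > 0) (X Y : ℝ) :
    Set.ncard {B : ℝ × ℝ | B.1 ^ 2 / a ^ 2 + B.2 ^ 2 / b ^ 2 = 1 ∧
        a ^ 2 * B.2 * (X - B.1) = b ^ 2 * B.1 * (Y - B.2)} =
      (circleFeet (a * X / (a ^ 2 - b ^ 2)) (b * Y / (a ^ 2 - b ^ 2))).ncard := by
  have ha : a ≠ 0 := by linarith
  have hb' : b ≠ 0 := hb.ne'
  have hk : a ^ 2 - b ^ 2 ≠ 0 := by nlinarith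
  symm
  have iff_scaled : ∀ c s : ℝ,
      (c, s) ∈ circleFeet (a * X / (a ^ 2 - b ^ 2)) (b * Y / (a ^ 2 - b ^ 2)) ↔
      c ^ 2 + s ^ 2 = 1 ∧ a * s * (X - a * c) = b * c * (Y - b * s) := by
    intro c s
    simp only [circleFeet, Set.mem_ofPred_eq]
    refine and_congr_right fun _ => ?_
    field_simp
    constructor <;> intro h <;> linarith
  refine Set.ncard_congr (fun z _ => (a * z.1, b * z.2)) ?_ ?_ ?_
  · rintro ⟨c, s⟩ h
    obtain ⟨h₁, h₂⟩ := (iff_scaled c s).1 h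
    refine ⟨?_, ?_⟩
    · simp only
      field_simp
      exact h₁
    · simp only
      linear_combination a * b * h₂
  · rintro ⟨c, s⟩ ⟨c', s'⟩ _ _ h
    simpa [ha, hb'] using h
  · rintro ⟨x, y⟩ ⟨h₁, h₂⟩
    simp only at h₁ h₂
    refine ⟨(x / a, y / b), (iff_scaled _ _).2 ⟨?_, ?_⟩, ?_⟩
    · rw [div_pow, div_pow, h₁]
    · field_simp
      linarith
    · simp only [mul_div_cancel₀ _ ha, mul_div_cancel₀ _ hb']

theorem exists_cube_eq_abs_div (m : ℝ) {k : ℝ} (hk : 0 < k) :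
    ∃ u : ℝ, 0 ≤ u ∧ u ^ 3 = |m / k| ∧
      (m ^ 2) ^ ((1 : ℝ) / 3) = u ^ 2 * (k ^ 2) ^ ((1 : ℝ) / 3) := by
  refine ⟨|m / k| ^ ((1 : ℝ) / 3), by positivity, ?_, ?_⟩
  · rw [← Real.rpow_natCast, ← Real.rpow_mul (abs_nonneg _)]
    norm_num
  · have : (|m / k| ^ ((1 : ℝ) / 3)) ^ 2 = (|m / k| ^ 2) ^ ((1 : ℝ) / 3) := by
      rw [← Real.rpow_natCast, ← Real.rpow_natCast, ← Real.rpow_mul (abs_nonneg _),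
        ← Real.rpow_mul (abs_nonneg _), mul_comm]
    rw [this, ← Real.mul_rpow (by positivity) (by positivity), sq_abs]
    congr 1
    field_simp

/-- Apollonius problem for the ellipse: if `A = (X, Y)` lies strictly inside the
astroid (the evolute of the ellipse `x²/a² + y²/b² = 1`), then the number of feet
of normals from `A` is 4; if `A` lies strictly outside the astroid, it is 2. -/
theorem stmt_0 (a b : ℝ) (hab : a > b) (hb : b > 0) (X Y : ℝ) :
    ((a ^ 2 * X ^ 2) ^ ((1 : ℝ) / 3) + (b ^ 2 * Y ^ 2) ^ ((1 : ℝ) / 3)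
        < ((a ^ 2 - b ^ 2) ^ 2) ^ ((1 : ℝ) / 3) →
      Set.ncard {B : ℝ × ℝ | B.1 ^ 2 / a ^ 2 + B.2 ^ 2 / b ^ 2 = 1 ∧
        a ^ 2 * B.2 * (X - B.1) = b ^ 2 * B.1 * (Y - B.2)} = 4) ∧
    ((a ^ 2 * X ^ 2) ^ ((1 : ℝ) / 3) + (b ^ 2 * Y ^ 2) ^ ((1 : ℝ) / 3)
        > ((a ^ 2 - b ^ 2) ^ 2) ^ ((1 : ℝ) / 3) →
      Set.ncard {B : ℝ × ℝ | B.1 ^ 2 / a ^ 2 + B.2 ^ 2 / b ^ 2 = 1 ∧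
        a ^ 2 * B.2 * (X - B.1) = b ^ 2 * B.1 * (Y - B.2)} = 2) := by
  have hk : 0 < a ^ 2 - b ^ 2 := by nlinarith
  have hk' : 0 < ((a ^ 2 - b ^ 2) ^ 2) ^ ((1 : ℝ) / 3) := by positivity
  obtain ⟨u, hu, hu3, hu2⟩ := exists_cube_eq_abs_div (a * X) hk
  obtain ⟨v, hv, hv3, hv2⟩ := exists_cube_eq_abs_div (b * Y) hk
  rw [ncard_feet_eq_ncard_circleFeet hab hb, ← ncard_circleFeet_abs, ← hu3, ← hv3,
    ← mul_pow, ← mul_pow, hu2, hv2, ← add_mul]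
  exact ⟨fun h => ncard_circleFeet_inside hu hv ((mul_lt_iff_lt_one_left hk').1 h),
    fun h => ncard_circleFeet_outside hu hv ((lt_mul_iff_one_lt_left hk').1 h)⟩
end

section
/- Let a > b > 0 and let A = (X,Y) ∈ ℝ² be a point on the astroid, i.e., (a²X²)^(1/3) + (b²Y²)^(1/3) = ((a²−b²)²)^(1/3). If A is not one of the four vertices (±(a²−b²)/a, 0) and (0, ±(a²−b²)/b), then n(A) = 3; if A is one of these four vertices, then n(A) = 2. -/
open Set

/-- Every real number has a real cube root. -/
theorem exists_real_pow_three_eq (x : ℝ) : ∃ y : ℝ, y ^ 3 = x := by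
  have hodd : Odd 3 := by decide
  have hmono : Monotone fun r : ℝ => r ^ 3 := hodd.strictMono_pow.monotone
  have hle (r : ℝ) : r ≤ max r 1 ^ 3 :=
    (le_max_left r 1).trans (le_self_pow₀ (le_max_right r 1) three_ne_zero)
  have htop : Filter.Tendsto (fun r : ℝ => r ^ 3) Filter.atTop Filter.atTop :=
    Filter.tendsto_pow_atTop three_ne_zero
  have hbot : Filter.Tendsto (fun r : ℝ => r ^ 3) Filter.atBot Filter.atBot := by
    refine Filter.tendsto_atBot_atBot_of_monotone hmono fun r => ⟨-max (-r) 1, ?_⟩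
    rw [hodd.neg_pow]
    linarith [hle (-r)]
  exact (continuous_pow 3).surjective htop hbot x

theorem mul_pow_six_rpow_one_third {k : ℝ} (hk : 0 ≤ k) (p : ℝ) :
    (k * p ^ 6) ^ ((1 : ℝ) / 3) = k ^ ((1 : ℝ) / 3) * p ^ 2 := by
  rw [Real.mul_rpow hk (by positivity), show p ^ 6 = (p ^ 2) ^ 3 by ring]
  congr 1
  simpa using Real.pow_rpow_inv_natCast (sq_nonneg p) three_ne_zero

/-- A point of the astroid is `((a² - b²) p³ / a, -(a² - b²) q³ / b)` for some `(p, q)` on the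
unit circle. -/
theorem exists_astroid_param {a b X Y : ℝ} (hab : a > b) (hb : b > 0)
    (hA : (a ^ 2 * X ^ 2) ^ ((1 : ℝ) / 3) + (b ^ 2 * Y ^ 2) ^ ((1 : ℝ) / 3)
      = ((a ^ 2 - b ^ 2) ^ 2) ^ ((1 : ℝ) / 3)) :
    ∃ p q : ℝ, p ^ 2 + q ^ 2 = 1 ∧ a * X = (a ^ 2 - b ^ 2) * p ^ 3 ∧
      b * Y = -((a ^ 2 - b ^ 2) * q ^ 3) := by
  have hc : 0 < a ^ 2 - b ^ 2 := by nlinarith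
  obtain ⟨p, hp⟩ := exists_real_pow_three_eq (a * X / (a ^ 2 - b ^ 2))
  obtain ⟨q, hq⟩ := exists_real_pow_three_eq (-(b * Y) / (a ^ 2 - b ^ 2))
  have hX : a * X = (a ^ 2 - b ^ 2) * p ^ 3 := by rw [hp]; field_simp
  have hY : b * Y = -((a ^ 2 - b ^ 2) * q ^ 3) := by rw [hq]; field_simp
  refine ⟨p, q, ?_, hX, hY⟩
  have hX2 : a ^ 2 * X ^ 2 = (a ^ 2 - b ^ 2) ^ 2 * p ^ 6 := by rw [← mul_pow, hX]; ring
  have hY2 : b ^ 2 * Y ^ 2 = (a ^ 2 - b ^ 2) ^ 2 * q ^ 6 := by rw [← mul_pow, hY]; ring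
  rw [hX2, hY2, mul_pow_six_rpow_one_third (sq_nonneg _),
    mul_pow_six_rpow_one_third (sq_nonneg _), ← mul_add] at hA
  exact (mul_eq_left₀ (Real.rpow_pos_of_pos (pow_pos hc 2) _).ne').1 hA

/-- On the unit circle, the conic `v p³ + u q³ = u v` meets the circle in its tangent line at
`(p, q)` and a second chord. -/
theorem circle_normal_iff {p q u v : ℝ} (hpq : p ^ 2 + q ^ 2 = 1) (huv : u ^ 2 + v ^ 2 = 1) :
    v * p ^ 3 + u * q ^ 3 = u * v ↔
      (u = p ∧ v = q) ∨ q * u + p * v = -(p * q) := by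
  have key : u * v - (v * p ^ 3 + u * q ^ 3)
      = (p * u + q * v - 1) * (q * u + p * v + p * q) := by
    linear_combination (-p * q) * huv + (-u * v - q * u - p * v) * hpq
  rw [eq_comm, ← sub_eq_zero, key, mul_eq_zero]
  refine or_congr ⟨fun h => ?_, ?_⟩ (by rw [← sub_eq_zero (b := -(p * q)), sub_neg_eq_add])
  · have h2 : (u - p) ^ 2 + (v - q) ^ 2 = 0 := by linear_combination huv + hpq - 2 * h
    constructor <;> nlinarith [sq_nonneg (u - p), sq_nonneg (v - q)]
  · rintro ⟨rfl, rfl⟩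
    linear_combination hpq

theorem circle_chord_iff {p q s u v : ℝ} (hpq : p ^ 2 + q ^ 2 = 1)
    (hs : s ^ 2 = 1 - p ^ 2 * q ^ 2) :
    (u ^ 2 + v ^ 2 = 1 ∧ q * u + p * v = -(p * q)) ↔
      (u = p * s - p * q ^ 2 ∧ v = -(q * s) - p ^ 2 * q) ∨
      (u = -(p * s) - p * q ^ 2 ∧ v = q * s - p ^ 2 * q) := by
  constructor
  · rintro ⟨huv, hl⟩
    have hu : u = p * (p * u - q * v) - p * q ^ 2 := by
      linear_combination (-u) * hpq + q * hl
    have hv : v = -(q * (p * u - q * v)) - p ^ 2 * q := by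
      linear_combination (-v) * hpq + p * hl
    have ht : (p * u - q * v) ^ 2 = s ^ 2 := by
      linear_combination (p ^ 2 + q ^ 2) * huv + hpq - hs - (q * u + p * v - p * q) * hl
    rcases sq_eq_sq_iff_eq_or_eq_neg.1 ht with h | h <;> rw [h] at hu hv
    · exact Or.inl ⟨hu, hv⟩
    · exact Or.inr ⟨by linear_combination hu, by linear_combination hv⟩
  · rintro (⟨rfl, rfl⟩ | ⟨rfl, rfl⟩)
    · constructor
      · linear_combination (s ^ 2 + p ^ 2 * q ^ 2) * hpq + hs
      · linear_combination (-p * q) * hpq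
    · constructor
      · linear_combination (s ^ 2 + p ^ 2 * q ^ 2) * hpq + hs
      · linear_combination (-p * q) * hpq

/-- The feet of the normals from a point of the astroid. -/
theorem normal_feet_eq {a b X Y p q s : ℝ} (hab : a > b) (hb : b > 0)
    (hpq : p ^ 2 + q ^ 2 = 1) (hX : a * X = (a ^ 2 - b ^ 2) * p ^ 3)
    (hY : b * Y = -((a ^ 2 - b ^ 2) * q ^ 3)) (hs : s ^ 2 = 1 - p ^ 2 * q ^ 2) :
    {B : ℝ × ℝ | B.1 ^ 2 / a ^ 2 + B.2 ^ 2 / b ^ 2 = 1 ∧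
      a ^ 2 * B.2 * (X - B.1) = b ^ 2 * B.1 * (Y - B.2)} =
    Prod.map (a * ·) (b * ·) '' {(p, q), (p * s - p * q ^ 2, -(q * s) - p ^ 2 * q),
      (-(p * s) - p * q ^ 2, q * s - p ^ 2 * q)} := by
  have ha : 0 < a := hb.trans hab
  have hc : a ^ 2 - b ^ 2 ≠ 0 := by nlinarith
  have hsurj : Function.Surjective (Prod.map (a * ·) (b * ·) : ℝ × ℝ → ℝ × ℝ) :=
    (mul_left_surjective₀ ha.ne').prodMap (mul_left_surjective₀ hb.ne')
  have hinj : Function.Injective (Prod.map (a * ·) (b * ·) : ℝ × ℝ → ℝ × ℝ) :=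
    (mul_right_injective₀ ha.ne').prodMap (mul_right_injective₀ hb.ne')
  ext B
  obtain ⟨⟨u, v⟩, rfl⟩ := hsurj B
  rw [hinj.mem_set_image]
  have hell : (a * u) ^ 2 / a ^ 2 + (b * v) ^ 2 / b ^ 2 = u ^ 2 + v ^ 2 := by
    field_simp
  have hnor : a ^ 2 * (b * v) * (X - a * u) = b ^ 2 * (a * u) * (Y - b * v) ↔
      v * p ^ 3 + u * q ^ 3 = u * v := by
    rw [← sub_eq_zero, ← sub_eq_zero (a := v * p ^ 3 + u * q ^ 3),
      show a ^ 2 * (b * v) * (X - a * u) - b ^ 2 * (a * u) * (Y - b * v)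
        = (a * b * (a ^ 2 - b ^ 2)) * (v * p ^ 3 + u * q ^ 3 - u * v) by
        linear_combination (a * b * v) * hX - (a * b * u) * hY]
    simp [ha.ne', hb.ne', hc]
  simp only [mem_ofPred_eq, Prod.map_apply, hell, hnor, mem_insert_iff, mem_singleton_iff,
    Prod.mk.injEq]
  rw [← circle_chord_iff hpq hs]
  constructor
  · rintro ⟨huv, h⟩
    exact ((circle_normal_iff hpq huv).1 h).imp_right fun h => ⟨huv, h⟩
  · rintro (⟨rfl, rfl⟩ | ⟨huv, h⟩)
    · exact ⟨hpq, (circle_normal_iff hpq hpq).2 (Or.inl ⟨rfl, rfl⟩)⟩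
    · exact ⟨huv, (circle_normal_iff hpq huv).2 (Or.inr h)⟩

/-- The point of the astroid with parameter `(p, q)` is a vertex if and only if `p = 0` or
`q = 0`. -/
theorem astroid_vertex_iff {a b X Y p q : ℝ} (hab : a > b) (hb : b > 0)
    (hpq : p ^ 2 + q ^ 2 = 1) (hX : a * X = (a ^ 2 - b ^ 2) * p ^ 3)
    (hY : b * Y = -((a ^ 2 - b ^ 2) * q ^ 3)) :
    ((X, Y) : ℝ × ℝ) ∈ ({((a ^ 2 - b ^ 2) / a, 0), (-((a ^ 2 - b ^ 2) / a), 0),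
        (0, (a ^ 2 - b ^ 2) / b), (0, -((a ^ 2 - b ^ 2) / b))} : Set (ℝ × ℝ)) ↔
      p = 0 ∨ q = 0 := by
  have ha : 0 < a := hb.trans hab
  have hc : a ^ 2 - b ^ 2 ≠ 0 := by nlinarith
  have hp0 : X = 0 → p = 0 := by rintro rfl; simpa [hc] using hX
  have hq0 : Y = 0 → q = 0 := by rintro rfl; simpa [hc] using hY
  have hX' : X = (a ^ 2 - b ^ 2) * p ^ 3 / a := by rw [← hX]; field_simp
  have hY' : Y = -((a ^ 2 - b ^ 2) * q ^ 3) / b := by rw [← hY]; field_simp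
  simp only [mem_insert_iff, mem_singleton_iff, Prod.mk.injEq]
  constructor
  · rintro (⟨-, h⟩ | ⟨-, h⟩ | ⟨h, -⟩ | ⟨h, -⟩)
    · exact Or.inr (hq0 h)
    · exact Or.inr (hq0 h)
    · exact Or.inl (hp0 h)
    · exact Or.inl (hp0 h)
  · rintro (rfl | rfl)
    · rcases (by simpa using hpq : q = 1 ∨ q = -1) with rfl | rfl <;>
        simp [hX', hY', neg_div, -neg_sub, Odd.neg_pow (by decide : Odd 3)]
    · rcases (by simpa using hpq : p = 1 ∨ p = -1) with rfl | rfl <;>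
        simp [hX', hY', neg_div, -neg_sub, Odd.neg_pow (by decide : Odd 3)]

/-- If `A = (X, Y)` lies on the astroid (the evolute of the ellipse
`x²/a² + y²/b² = 1`) and is not one of the four vertices of the astroid, then the
number of feet of normals from `A` is 3; at the four vertices it is 2. -/
theorem stmt_1 (a b : ℝ) (hab : a > b) (hb : b > 0) (X Y : ℝ)
    (hA : (a ^ 2 * X ^ 2) ^ ((1 : ℝ) / 3) + (b ^ 2 * Y ^ 2) ^ ((1 : ℝ) / 3)
      = ((a ^ 2 - b ^ 2) ^ 2) ^ ((1 : ℝ) / 3)) :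
    (((X, Y) : ℝ × ℝ) ∉ ({((a ^ 2 - b ^ 2) / a, 0), (-((a ^ 2 - b ^ 2) / a), 0),
        (0, (a ^ 2 - b ^ 2) / b), (0, -((a ^ 2 - b ^ 2) / b))} : Set (ℝ × ℝ)) →
      Set.ncard {B : ℝ × ℝ | B.1 ^ 2 / a ^ 2 + B.2 ^ 2 / b ^ 2 = 1 ∧
        a ^ 2 * B.2 * (X - B.1) = b ^ 2 * B.1 * (Y - B.2)} = 3) ∧
    (((X, Y) : ℝ × ℝ) ∈ ({((a ^ 2 - b ^ 2) / a, 0), (-((a ^ 2 - b ^ 2) / a), 0),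
        (0, (a ^ 2 - b ^ 2) / b), (0, -((a ^ 2 - b ^ 2) / b))} : Set (ℝ × ℝ)) →
      Set.ncard {B : ℝ × ℝ | B.1 ^ 2 / a ^ 2 + B.2 ^ 2 / b ^ 2 = 1 ∧
        a ^ 2 * B.2 * (X - B.1) = b ^ 2 * B.1 * (Y - B.2)} = 2) := by
  obtain ⟨p, q, hpq, hX, hY⟩ := exists_astroid_param hab hb hA
  have hlt : 0 < 1 - p ^ 2 * q ^ 2 := by nlinarith [sq_nonneg (p ^ 2 - q ^ 2)]
  obtain ⟨s, hs0, hs⟩ : ∃ s : ℝ, 0 < s ∧ s ^ 2 = 1 - p ^ 2 * q ^ 2 :=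
    ⟨√(1 - p ^ 2 * q ^ 2), Real.sqrt_pos.2 hlt, Real.sq_sqrt hlt.le⟩
  have hinj : Function.Injective (Prod.map (a * ·) (b * ·) : ℝ × ℝ → ℝ × ℝ) :=
    (mul_right_injective₀ (hb.trans hab).ne').prodMap (mul_right_injective₀ hb.ne')
  rw [astroid_vertex_iff hab hb hpq hX hY, normal_feet_eq hab hb hpq hX hY hs,
    ncard_image_of_injective _ hinj]
  constructor
  · intro h
    obtain ⟨hp, hq⟩ := not_or.1 h
    have hoff : ∀ u v : ℝ, q * u + p * v = -(p * q) → (p, q) ≠ (u, v) := by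
      rintro u v h h'
      obtain ⟨rfl, rfl⟩ := Prod.mk.inj h'
      exact mul_ne_zero hp hq (by linarith)
    refine ncard_eq_three.2 ⟨_, _, _, hoff _ _ ?_, hoff _ _ ?_, fun h' => ?_, rfl⟩
    · linear_combination (-p * q) * hpq
    · linear_combination (-p * q) * hpq
    · exact mul_ne_zero hp hs0.ne' (by linarith [(Prod.mk.inj h').1])
  · rintro (rfl | rfl)
    · obtain rfl : s = 1 := by nlinarith
      have hq : q ≠ 0 := by rintro rfl; norm_num at hpq
      rw [show ({(0, q), (0 * 1 - 0 * q ^ 2, -(q * 1) - 0 ^ 2 * q),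
        (-(0 * 1) - 0 * q ^ 2, q * 1 - 0 ^ 2 * q)} : Set (ℝ × ℝ)) = {(0, -q), (0, q)} by
        simp]
      exact ncard_pair fun h => hq (by linarith [(Prod.mk.inj h).2])
    · obtain rfl : s = 1 := by nlinarith
      have hp : p ≠ 0 := by rintro rfl; norm_num at hpq
      rw [show ({(p, 0), (p * 1 - p * 0 ^ 2, -(0 * 1) - p ^ 2 * 0),
        (-(p * 1) - p * 0 ^ 2, 0 * 1 - p ^ 2 * 0)} : Set (ℝ × ℝ)) = {(p, 0), (-p, 0)} by
        simp]
      exact ncard_pair fun h => hp (by linarith [(Prod.mk.inj h).1])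
end

section
/- Let a > b > 0 with a² > 2b², and set x₀ = √(a⁴(a²−2b²)³/((a²−b²)(a²+b²)³)). Then for every point A = (X,Y) on the ellipse E: if |X| < x₀ then n(A) = 4; if |X| = x₀ then n(A) = 3; and if |X| > x₀ then n(A) = 2. -/
open Set

lemma exists_root_cubic (k e f g : ℝ) (hk : k ≠ 0) :
    ∃ r : ℝ, k * r ^ 3 + e * r ^ 2 + f * r + g = 0 := by
  wlog hpos : 0 < k generalizing k e f g
  · obtain ⟨r, hr⟩ := this (-k) (-e) (-f) (-g) (neg_ne_zero.mpr hk)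
      (neg_pos.mpr (lt_of_le_of_ne (not_lt.mp hpos) hk))
    exact ⟨r, by linear_combination -hr⟩
  set R : ℝ := 1 + (|e| + |f| + |g|) / k with hR
  have hkR : k * R = k + |e| + |f| + |g| := by rw [hR]; field_simp; ring
  have hR1 : 1 ≤ R := le_add_of_nonneg_right (by positivity)
  have hsq : R ≤ R ^ 2 := by nlinarith
  have hf1 : |f| * R ≤ |f| * R ^ 2 := mul_le_mul_of_nonneg_left hsq (abs_nonneg f)
  have hg1 : |g| ≤ |g| * R ^ 2 := le_mul_of_one_le_right (abs_nonneg g) (hR1.trans hsq)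
  have hcube : k * R ^ 3 = (k + |e| + |f| + |g|) * R ^ 2 := by rw [← hkR]; ring
  have hkR2 : 0 < k * R ^ 2 := by positivity
  have he2 := mul_le_mul_of_nonneg_right (neg_abs_le e) (sq_nonneg R)
  have he3 := mul_le_mul_of_nonneg_right (le_abs_self e) (sq_nonneg R)
  have hf2 := mul_le_mul_of_nonneg_right (neg_abs_le f) (zero_le_one.trans hR1)
  have hright : 0 ≤ k * R ^ 3 + e * R ^ 2 + f * R + g := by
    linarith [neg_abs_le g]
  have hleft : k * (-R) ^ 3 + e * (-R) ^ 2 + f * (-R) + g ≤ 0 := by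
    have h : k * (-R) ^ 3 + e * (-R) ^ 2 + f * (-R) + g
        = -(k * R ^ 3) + e * R ^ 2 - f * R + g := by ring
    linarith [le_abs_self g]
  exact mem_range_of_exists_le_of_exists_ge
    (f := fun r : ℝ => k * r ^ 3 + e * r ^ 2 + f * r + g) (by fun_prop) ⟨_, hleft⟩ ⟨_, hright⟩

/-- The discriminant of the cubic `k t³ + e t² + f t + g`. -/
def cubicDiscr (k e f g : ℝ) : ℝ :=
  e ^ 2 * f ^ 2 - 4 * k * f ^ 3 - 4 * e ^ 3 * g - 27 * k ^ 2 * g ^ 2 + 18 * k * e * f * g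

lemma exists_cubic_factorization (k e f g : ℝ) (hk : k ≠ 0) :
    ∃ r u v : ℝ, (∀ t, k * t ^ 3 + e * t ^ 2 + f * t + g = k * ((t - r) * (t ^ 2 + u * t + v))) ∧
      cubicDiscr k e f g = k ^ 4 * (u ^ 2 - 4 * v) * (r ^ 2 + u * r + v) ^ 2 ∧
      e = k * (u - r) ∧ f = k * (v - u * r) := by
  obtain ⟨r, hr⟩ := exists_root_cubic k e f g hk
  obtain ⟨u, rfl⟩ : ∃ u, e = k * (u - r) := ⟨e / k + r, by field_simp; ring⟩
  obtain ⟨v, rfl⟩ : ∃ v, f = k * (v - u * r) := ⟨f / k + u * r, by field_simp; ring⟩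
  obtain rfl : g = -(k * v * r) := by linear_combination hr
  exact ⟨r, u, v, fun t => by ring, by unfold cubicDiscr; ring, rfl, rfl⟩

lemma ncard_roots_cubic_of_discr_pos (k e f g : ℝ) (hk : k ≠ 0) (h : 0 < cubicDiscr k e f g) :
    {t : ℝ | k * t ^ 3 + e * t ^ 2 + f * t + g = 0}.ncard = 3 := by
  obtain ⟨r, u, v, hfac, hdisc, -, -⟩ := exists_cubic_factorization k e f g hk
  rw [hdisc] at h
  have hq : r ^ 2 + u * r + v ≠ 0 := fun h0 => by simp [h0] at h
  have hpos : 0 < u ^ 2 - 4 * v := by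
    by_contra! hle
    have := mul_nonneg (by positivity : 0 ≤ k ^ 4) (sq_nonneg (r ^ 2 + u * r + v))
    nlinarith
  set d := √(u ^ 2 - 4 * v) with hd
  have hd0 : 0 < d := Real.sqrt_pos.mpr hpos
  have hd2 : d ^ 2 = u ^ 2 - 4 * v := Real.sq_sqrt hpos.le
  have hset : {t : ℝ | k * t ^ 3 + e * t ^ 2 + f * t + g = 0}
      = {r, (-u + d) / 2, (-u - d) / 2} := by
    ext t
    have hquad : t ^ 2 + u * t + v = (t - (-u + d) / 2) * (t - (-u - d) / 2) := by
      linear_combination hd2 / 4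
    simp [hfac, hk, hquad, sub_eq_zero]
  rw [hset, ncard_eq_three]
  refine ⟨_, _, _, ?_, ?_, ?_, rfl⟩
  · intro hr
    exact hq (by rw [hr]; linear_combination hd2 / 4)
  · intro hr
    exact hq (by rw [hr]; linear_combination hd2 / 4)
  · intro hr
    linarith

lemma ncard_roots_cubic_of_discr_neg (k e f g : ℝ) (hk : k ≠ 0) (h : cubicDiscr k e f g < 0) :
    {t : ℝ | k * t ^ 3 + e * t ^ 2 + f * t + g = 0}.ncard = 1 := by
  obtain ⟨r, u, v, hfac, hdisc, -, -⟩ := exists_cubic_factorization k e f g hk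
  rw [hdisc] at h
  have hneg : u ^ 2 - 4 * v < 0 := by
    by_contra! hle
    have : 0 ≤ k ^ 4 * (u ^ 2 - 4 * v) * (r ^ 2 + u * r + v) ^ 2 := by positivity
    linarith
  rw [ncard_eq_one]
  refine ⟨r, ?_⟩
  ext t
  have hquad : t ^ 2 + u * t + v ≠ 0 := by nlinarith [sq_nonneg (2 * t + u)]
  simp [hfac, hk, hquad, sub_eq_zero]

lemma ncard_roots_cubic_of_discr_eq_zero (k e f g : ℝ) (hk : k ≠ 0)
    (h : cubicDiscr k e f g = 0) (hef : e ^ 2 ≠ 3 * k * f) :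
    {t : ℝ | k * t ^ 3 + e * t ^ 2 + f * t + g = 0}.ncard = 2 := by
  obtain ⟨r, u, v, hfac, hdisc, he, hf⟩ := exists_cubic_factorization k e f g hk
  rw [he, hf] at hef
  have hor : u ^ 2 - 4 * v = 0 ∨ r ^ 2 + u * r + v = 0 := by
    simpa [hk] using hdisc.symm.trans h
  rw [ncard_eq_two]
  rcases hor with h0 | h0
  · obtain rfl : v = u ^ 2 / 4 := by linarith
    refine ⟨r, -u / 2, fun hr => hef (by rw [hr]; ring), ?_⟩
    ext t
    have hquad : t ^ 2 + u * t + u ^ 2 / 4 = (t - -u / 2) ^ 2 := by ring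
    simp [hfac, hk, hquad, sub_eq_zero]
  · obtain rfl : v = -r ^ 2 - u * r := by linarith
    refine ⟨r, -u - r, fun hr => hef ?_, ?_⟩
    · obtain rfl : u = -2 * r := by linarith
      ring
    · ext t
      have hquad : t ^ 2 + u * t + (-r ^ 2 - u * r) = (t - r) * (t - (-u - r)) := by ring
      simp [hfac, hk, hquad, sub_eq_zero]

/-- The point of the unit circle obtained by rotating `(c, s)` through `2 arccot w`. -/
noncomputable def circlePoint (c s w : ℝ) : ℝ × ℝ :=
  (((w ^ 2 - 1) * c - 2 * w * s) / (w ^ 2 + 1), ((w ^ 2 - 1) * s + 2 * w * c) / (w ^ 2 + 1))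

section circle

variable {c s : ℝ}

lemma circlePoint_sq_add_sq (h : c ^ 2 + s ^ 2 = 1) (w : ℝ) :
    (circlePoint c s w).1 ^ 2 + (circlePoint c s w).2 ^ 2 = 1 := by
  simp only [circlePoint]
  field_simp
  linear_combination (w ^ 2 + 1) ^ 2 * h

lemma one_sub_circlePoint (h : c ^ 2 + s ^ 2 = 1) (w : ℝ) :
    1 - (circlePoint c s w).1 * c - (circlePoint c s w).2 * s = 2 / (w ^ 2 + 1) := by
  simp only [circlePoint]
  field_simp
  linear_combination (1 - w ^ 2) * h

lemma cross_circlePoint (h : c ^ 2 + s ^ 2 = 1) (w : ℝ) :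
    (circlePoint c s w).2 * c - (circlePoint c s w).1 * s = 2 * w / (w ^ 2 + 1) := by
  simp only [circlePoint]
  field_simp
  linear_combination (2 * w) * h

lemma circlePoint_injective (h : c ^ 2 + s ^ 2 = 1) : Function.Injective (circlePoint c s) := by
  intro w z hwz
  have h1 := one_sub_circlePoint h w
  have h2 := cross_circlePoint h w
  rw [hwz, one_sub_circlePoint h z] at h1
  rw [hwz, cross_circlePoint h z] at h2
  have h3 : w * (2 / (w ^ 2 + 1)) = z * (2 / (z ^ 2 + 1)) := by
    linear_combination -h2
  rw [h1] at h3
  exact mul_right_cancel₀ (by positivity) h3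

lemma circlePoint_ne (h : c ^ 2 + s ^ 2 = 1) (w : ℝ) : circlePoint c s w ≠ (c, s) := by
  intro hw
  have h1 := one_sub_circlePoint h w
  rw [hw] at h1
  have h2 : 0 < 2 / (w ^ 2 + 1) := by positivity
  rw [← h1] at h2
  nlinarith

lemma exists_circlePoint_eq (h : c ^ 2 + s ^ 2 = 1) {u v : ℝ} (huv : u ^ 2 + v ^ 2 = 1)
    (hne : (u, v) ≠ (c, s)) : ∃ w, circlePoint c s w = (u, v) := by
  obtain ⟨d, hd⟩ : ∃ d, d = 1 - u * c - v * s := ⟨_, rfl⟩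
  obtain ⟨x, hx⟩ : ∃ x, x = v * c - u * s := ⟨_, rfl⟩
  have hd0 : d ≠ 0 := by
    rintro rfl
    have h0 : (u - c) ^ 2 + (v - s) ^ 2 = 0 := by linear_combination huv + h - 2 * hd
    refine hne (Prod.ext ?_ ?_) <;> dsimp only <;> nlinarith [sq_nonneg (u - c), sq_nonneg (v - s)]
  have hxd : x ^ 2 = 2 * d - d ^ 2 := by
    rw [hx, hd]
    linear_combination (c ^ 2 + s ^ 2) * huv + h
  have hw : (x / d) ^ 2 = 2 / d - 1 := by
    rw [div_pow, hxd]
    field_simp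
  refine ⟨x / d, Prod.ext ?_ ?_⟩
  · have hu : (1 - d) * c - x * s = u := by
      rw [hx, hd]
      linear_combination u * h
    rw [← hu]
    simp only [circlePoint, hw]
    field_simp
    ring
  · have hv : (1 - d) * s + x * c = v := by
      rw [hx, hd]
      linear_combination v * h
    rw [← hv]
    simp only [circlePoint, hw]
    field_simp
    ring

/-- The parameters `w` for which `circlePoint c s w`, stretched by `a` and `b` along the axes, is
the foot of a normal of the ellipse from `(a c, b s)`. -/
def footParameters (a b c s : ℝ) : Set ℝ :=
  {w | (a ^ 2 + b ^ 2 - (a ^ 2 - b ^ 2) * (c ^ 2 - s ^ 2)) * w ^ 3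
    + 6 * (a ^ 2 - b ^ 2) * c * s * w ^ 2
    + (a ^ 2 + b ^ 2 + 3 * (a ^ 2 - b ^ 2) * (c ^ 2 - s ^ 2)) * w
    + -(2 * (a ^ 2 - b ^ 2) * c * s) = 0}

lemma normal_circlePoint_iff (h : c ^ 2 + s ^ 2 = 1) (a b w : ℝ) :
    a ^ 2 * (circlePoint c s w).2 * (c - (circlePoint c s w).1)
      = b ^ 2 * (circlePoint c s w).1 * (s - (circlePoint c s w).2) ↔
    w ∈ footParameters a b c s := by
  have hw : w ^ 2 + 1 ≠ 0 := by positivity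
  have key : a ^ 2 * (circlePoint c s w).2 * (c - (circlePoint c s w).1)
        - b ^ 2 * (circlePoint c s w).1 * (s - (circlePoint c s w).2)
      = ((a ^ 2 + b ^ 2 - (a ^ 2 - b ^ 2) * (c ^ 2 - s ^ 2)) * w ^ 3
        + 6 * (a ^ 2 - b ^ 2) * c * s * w ^ 2
        + (a ^ 2 + b ^ 2 + 3 * (a ^ 2 - b ^ 2) * (c ^ 2 - s ^ 2)) * w
        + -(2 * (a ^ 2 - b ^ 2) * c * s)) / (w ^ 2 + 1) ^ 2 := by
    rw [eq_div_iff (pow_ne_zero 2 hw)]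
    have hu : (circlePoint c s w).1 * (w ^ 2 + 1) = (w ^ 2 - 1) * c - 2 * w * s :=
      div_mul_cancel₀ _ hw
    have hv : (circlePoint c s w).2 * (w ^ 2 + 1) = (w ^ 2 - 1) * s + 2 * w * c :=
      div_mul_cancel₀ _ hw
    generalize (circlePoint c s w).1 = u at hu ⊢
    generalize (circlePoint c s w).2 = v at hv ⊢
    calc (a ^ 2 * v * (c - u) - b ^ 2 * u * (s - v)) * (w ^ 2 + 1) ^ 2
        = a ^ 2 * (v * (w ^ 2 + 1)) * (c * (w ^ 2 + 1) - u * (w ^ 2 + 1))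
          - b ^ 2 * (u * (w ^ 2 + 1)) * (s * (w ^ 2 + 1) - v * (w ^ 2 + 1)) := by ring
      _ = _ := by
        rw [hu, hv]
        linear_combination ((a ^ 2 + b ^ 2) * (w ^ 3 + w)) * h
  rw [← sub_eq_zero, key, div_eq_zero_iff, or_iff_left (pow_ne_zero 2 hw)]
  rfl

lemma ncard_feet_circle (h : c ^ 2 + s ^ 2 = 1) (a b : ℝ)
    (hfin : (footParameters a b c s).Finite) :
    {p : ℝ × ℝ | p.1 ^ 2 + p.2 ^ 2 = 1 ∧
      a ^ 2 * p.2 * (c - p.1) = b ^ 2 * p.1 * (s - p.2)}.ncard =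
    (footParameters a b c s).ncard + 1 := by
  have hset : {p : ℝ × ℝ | p.1 ^ 2 + p.2 ^ 2 = 1 ∧
      a ^ 2 * p.2 * (c - p.1) = b ^ 2 * p.1 * (s - p.2)}
      = insert (c, s) (circlePoint c s '' footParameters a b c s) := by
    ext ⟨u, v⟩
    constructor
    · rintro ⟨huv, hn⟩
      by_cases hne : (u, v) = (c, s)
      · exact Or.inl hne
      · obtain ⟨w, hw⟩ := exists_circlePoint_eq h huv hne
        refine Or.inr ⟨w, (normal_circlePoint_iff h a b w).mp ?_, hw⟩
        rw [hw]
        exact hn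
    · rintro (hcs | ⟨w, hw, huv⟩)
      · obtain ⟨rfl, rfl⟩ := Prod.mk.inj hcs
        exact ⟨h, by simp⟩
      · rw [← huv]
        exact ⟨circlePoint_sq_add_sq h w, (normal_circlePoint_iff h a b w).mpr hw⟩
  rw [hset, ncard_insert_of_notMem _ (hfin.image _),
    ncard_image_of_injective _ (circlePoint_injective h)]
  rintro ⟨w, -, hw⟩
  exact circlePoint_ne h w hw

lemma ncard_feet_ellipse (h : c ^ 2 + s ^ 2 = 1) {a b : ℝ} (ha : a ≠ 0) (hb : b ≠ 0)
    (hfin : (footParameters a b c s).Finite) :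
    {B : ℝ × ℝ | B.1 ^ 2 / a ^ 2 + B.2 ^ 2 / b ^ 2 = 1 ∧
      a ^ 2 * B.2 * (a * c - B.1) = b ^ 2 * B.1 * (b * s - B.2)}.ncard =
    (footParameters a b c s).ncard + 1 := by
  have hinj : Function.Injective (fun p : ℝ × ℝ => (a * p.1, b * p.2)) := by
    rintro ⟨x, y⟩ ⟨x', y'⟩ hxy
    simpa [ha, hb] using hxy
  rw [← ncard_feet_circle h a b hfin, eq_comm, ← ncard_image_of_injective _ hinj]
  congr 1
  ext ⟨x, y⟩
  constructor
  · rintro ⟨⟨u, v⟩, ⟨h1, h2⟩, huv⟩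
    obtain ⟨rfl, rfl⟩ := Prod.mk.inj huv
    dsimp only at h1 h2
    refine ⟨?_, ?_⟩
    · dsimp only
      field_simp
      exact h1
    · dsimp only
      linear_combination a * b * h2
  · rintro ⟨h1, h2⟩
    refine ⟨(x / a, y / b), ⟨?_, ?_⟩, ?_⟩
    · simpa only [div_pow] using h1
    · dsimp only at h2 ⊢
      field_simp
      linear_combination h2
    · simp only [mul_div_cancel₀ _ ha, mul_div_cancel₀ _ hb]

lemma cubicDiscr_footParameters (h : c ^ 2 + s ^ 2 = 1) (a b : ℝ) :
    cubicDiscr (a ^ 2 + b ^ 2 - (a ^ 2 - b ^ 2) * (c ^ 2 - s ^ 2)) (6 * (a ^ 2 - b ^ 2) * c * s)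
        (a ^ 2 + b ^ 2 + 3 * (a ^ 2 - b ^ 2) * (c ^ 2 - s ^ 2)) (-(2 * (a ^ 2 - b ^ 2) * c * s))
      = 64 * (a ^ 2 * (a ^ 2 - 2 * b ^ 2) ^ 3
        - (a ^ 2 - b ^ 2) * (a ^ 2 + b ^ 2) ^ 3 * c ^ 2) := by
  have discr_odd (k m f x y : ℝ) : cubicDiscr k (3 * m * x * y) f (-(m * x * y))
      = 9 * m ^ 2 * x ^ 2 * y ^ 2 * f ^ 2 - 4 * k * f ^ 3 + 108 * m ^ 4 * (x ^ 2) ^ 2 * (y ^ 2) ^ 2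
        - 27 * k ^ 2 * m ^ 2 * x ^ 2 * y ^ 2 - 54 * k * f * m ^ 2 * x ^ 2 * y ^ 2 := by
    unfold cubicDiscr
    ring
  have hs : s ^ 2 = 1 - c ^ 2 := by linear_combination h
  rw [show 6 * (a ^ 2 - b ^ 2) * c * s = 3 * (2 * (a ^ 2 - b ^ 2)) * c * s by ring, discr_odd, hs]
  ring

lemma footParameters_leading_pos (h : c ^ 2 + s ^ 2 = 1) {a b : ℝ} (ha : a ≠ 0) (hb : b ≠ 0) :
    0 < a ^ 2 + b ^ 2 - (a ^ 2 - b ^ 2) * (c ^ 2 - s ^ 2) := by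
  have heq : a ^ 2 + b ^ 2 - (a ^ 2 - b ^ 2) * (c ^ 2 - s ^ 2)
      = 2 * ((a * s) ^ 2 + (b * c) ^ 2) := by linear_combination -(a ^ 2 + b ^ 2) * h
  rw [heq]
  by_cases hc : c = 0
  · have hs : s ≠ 0 := by
      rintro rfl
      simp [hc] at h
    positivity
  · positivity

lemma footParameters_no_triple_root (h : c ^ 2 + s ^ 2 = 1) {a b : ℝ} (hb : b ≠ 0)
    (h2 : 2 * b ^ 2 < a ^ 2)
    (hdisc : cubicDiscr (a ^ 2 + b ^ 2 - (a ^ 2 - b ^ 2) * (c ^ 2 - s ^ 2))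
      (6 * (a ^ 2 - b ^ 2) * c * s) (a ^ 2 + b ^ 2 + 3 * (a ^ 2 - b ^ 2) * (c ^ 2 - s ^ 2))
      (-(2 * (a ^ 2 - b ^ 2) * c * s)) = 0) :
    (6 * (a ^ 2 - b ^ 2) * c * s) ^ 2
      ≠ 3 * (a ^ 2 + b ^ 2 - (a ^ 2 - b ^ 2) * (c ^ 2 - s ^ 2))
        * (a ^ 2 + b ^ 2 + 3 * (a ^ 2 - b ^ 2) * (c ^ 2 - s ^ 2)) := by
  intro htriple
  have hb2 : 0 < b ^ 2 := by positivity
  have ha : a ≠ 0 := by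
    rintro rfl
    norm_num at h2
    linarith
  have hpos := footParameters_leading_pos h ha hb
  have hessian (k e f g : ℝ) (h0 : cubicDiscr k e f g = 0) (h1 : e ^ 2 = 3 * k * f) :
      e * f - 9 * k * g = 0 := by
    refine pow_eq_zero_iff two_ne_zero |>.mp ?_
    unfold cubicDiscr at h0
    linear_combination -3 * h0 + 4 * (f ^ 2 - 3 * e * g) * h1
  have hcs := hessian _ _ _ _ hdisc htriple
  have hcs' : 24 * ((a ^ 2 + b ^ 2) * (a ^ 2 - b ^ 2) * (c * s)) = 0 := by
    linear_combination hcs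
  have hsum : a ^ 2 + b ^ 2 ≠ 0 := by positivity
  have hdiff : a ^ 2 - b ^ 2 ≠ 0 := by linarith
  rcases (by simpa [hsum, hdiff] using hcs' : c = 0 ∨ s = 0) with rfl | rfl
  · have hs : s ^ 2 = 1 := by simpa using h
    rw [hs] at htriple hpos
    have := mul_pos hpos (by linarith : 0 < 2 * (a ^ 2 - 2 * b ^ 2))
    nlinarith
  · have hc : c ^ 2 = 1 := by simpa using h
    rw [hc] at htriple hpos
    have := mul_pos hpos (by linarith : 0 < 4 * a ^ 2 - 2 * b ^ 2)
    nlinarith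

end circle


/-- For `a² > 2b²`, the number of feet of normals from a point `A = (X, Y)` of the
ellipse itself is 4, 3 or 2 according as `|X| < x₀`, `|X| = x₀` or `|X| > x₀`,
where `(±x₀, ±y₀)` are the intersection points of the ellipse with its evolute. -/
theorem stmt_2 (a b : ℝ) (hab : a > b) (hb : b > 0) (h2 : a ^ 2 > 2 * b ^ 2)
    (X Y : ℝ) (hA : X ^ 2 / a ^ 2 + Y ^ 2 / b ^ 2 = 1)
    (x₀ : ℝ)
    (hx₀ : x₀ = Real.sqrt (a ^ 4 * (a ^ 2 - 2 * b ^ 2) ^ 3 /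
      ((a ^ 2 - b ^ 2) * (a ^ 2 + b ^ 2) ^ 3))) :
    (|X| < x₀ →
      Set.ncard {B : ℝ × ℝ | B.1 ^ 2 / a ^ 2 + B.2 ^ 2 / b ^ 2 = 1 ∧
        a ^ 2 * B.2 * (X - B.1) = b ^ 2 * B.1 * (Y - B.2)} = 4) ∧
    (|X| = x₀ →
      Set.ncard {B : ℝ × ℝ | B.1 ^ 2 / a ^ 2 + B.2 ^ 2 / b ^ 2 = 1 ∧
        a ^ 2 * B.2 * (X - B.1) = b ^ 2 * B.1 * (Y - B.2)} = 3) ∧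
    (|X| > x₀ →
      Set.ncard {B : ℝ × ℝ | B.1 ^ 2 / a ^ 2 + B.2 ^ 2 / b ^ 2 = 1 ∧
        a ^ 2 * B.2 * (X - B.1) = b ^ 2 * B.1 * (Y - B.2)} = 2) := by
  have ha : a > 0 := hb.trans hab
  obtain ⟨c, rfl⟩ : ∃ c, X = a * c := ⟨X / a, by field_simp⟩
  obtain ⟨s, rfl⟩ : ∃ s, Y = b * s := ⟨Y / b, by field_simp⟩
  have h : c ^ 2 + s ^ 2 = 1 := by
    field_simp at hA
    exact hA
  have hk := (footParameters_leading_pos h ha.ne' hb.ne').ne'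
  have hn : 0 < a ^ 2 - 2 * b ^ 2 := by linarith
  have hab2 : 0 < a ^ 2 - b ^ 2 := by nlinarith
  have hK : 0 < (a ^ 2 - b ^ 2) * (a ^ 2 + b ^ 2) ^ 3 := by positivity
  have hx₀_nonneg : 0 ≤ x₀ := hx₀ ▸ Real.sqrt_nonneg _
  have hx₀_sq : x₀ ^ 2 = a ^ 4 * (a ^ 2 - 2 * b ^ 2) ^ 3 /
      ((a ^ 2 - b ^ 2) * (a ^ 2 + b ^ 2) ^ 3) := by
    rw [hx₀, Real.sq_sqrt (by positivity)]
  have hdisc := cubicDiscr_footParameters h a b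
  have hcoef : 0 < 64 * ((a ^ 2 - b ^ 2) * (a ^ 2 + b ^ 2) ^ 3) / a ^ 2 := by positivity
  have hdisc' : 64 * (a ^ 2 * (a ^ 2 - 2 * b ^ 2) ^ 3
        - (a ^ 2 - b ^ 2) * (a ^ 2 + b ^ 2) ^ 3 * c ^ 2)
      = 64 * ((a ^ 2 - b ^ 2) * (a ^ 2 + b ^ 2) ^ 3) / a ^ 2 * (x₀ ^ 2 - (a * c) ^ 2) := by
    rw [hx₀_sq]
    field_simp
  rw [hdisc'] at hdisc
  have feet_of_roots {n : ℕ} (hn : n ≠ 0) (hroots : (footParameters a b c s).ncard = n) :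
      Set.ncard {B : ℝ × ℝ | B.1 ^ 2 / a ^ 2 + B.2 ^ 2 / b ^ 2 = 1 ∧
        a ^ 2 * B.2 * (a * c - B.1) = b ^ 2 * B.1 * (b * s - B.2)} = n + 1 := by
    rw [ncard_feet_ellipse h ha.ne' hb.ne' (finite_of_ncard_ne_zero (hroots ▸ hn)), hroots]
  refine ⟨fun hX => ?_, fun hX => ?_, fun hX => ?_⟩
  · refine feet_of_roots three_ne_zero (ncard_roots_cubic_of_discr_pos _ _ _ _ hk ?_)
    rw [hdisc]
    exact mul_pos hcoef (sub_pos.mpr (sq_lt_sq.mpr (by rwa [abs_of_nonneg hx₀_nonneg])))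
  · have hzero := hdisc.trans (by rw [← hX, sq_abs, sub_self, mul_zero])
    exact feet_of_roots two_ne_zero (ncard_roots_cubic_of_discr_eq_zero _ _ _ _ hk hzero
      (footParameters_no_triple_root h hb.ne' h2 hzero))
  · refine feet_of_roots one_ne_zero (ncard_roots_cubic_of_discr_neg _ _ _ _ hk ?_)
    rw [hdisc]
    exact mul_neg_of_pos_of_neg hcoef
      (sub_neg.mpr (sq_lt_sq.mpr (by rwa [abs_of_nonneg hx₀_nonneg])))
end

section
/- Let a > b > 0 with a² ≤ 2b². Then for every point A = (X,Y) on the ellipse E, n(A) = 2. -/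
open Real in
lemma exists_angle_of_sq_add_sq_eq_one {u v : ℝ} (h : u ^ 2 + v ^ 2 = 1) (φ : ℝ) :
    ∃ s ∈ Set.Ico 0 π, u = cos (φ + 2 * s) ∧ v = sin (φ + 2 * s) := by
  have hn : ‖(⟨u, v⟩ : ℂ)‖ = 1 := by
    rw [Complex.norm_def, Complex.normSq_mk, ← pow_two, ← pow_two, h, sqrt_one]
  have hz : (⟨u, v⟩ : ℂ) ≠ 0 := norm_ne_zero_iff.mp (by rw [hn]; exact one_ne_zero)
  set t := Complex.arg ⟨u, v⟩ with ht
  have hc : cos t = u := by rw [ht, Complex.cos_arg hz, hn, div_one]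
  have hs : sin t = v := by rw [ht, Complex.sin_arg, hn, div_one]
  have hmem := toIcoMod_mem_Ico two_pi_pos φ t
  have hmod := toIcoMod_add_toIcoDiv_zsmul two_pi_pos φ t
  refine ⟨(toIcoMod two_pi_pos φ t - φ) / 2,
    ⟨by linarith [hmem.1], by linarith [hmem.2]⟩, ?_, ?_⟩
  all_goals
    rw [mul_div_cancel₀ _ (two_ne_zero' ℝ), add_sub_cancel]
    rw [← hmod, zsmul_eq_mul] at hc hs
  · rw [← hc, cos_add_int_mul_two_pi]
  · rw [← hs, sin_add_int_mul_two_pi]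

open Real in
lemma cos_eq_cos_three_mul_add_unique {p q c s₁ s₂ : ℝ} (hq : 0 < q) (hqp : 3 * q ≤ p)
    (hs₁ : s₁ ∈ Set.Ioo 0 π) (hs₂ : s₂ ∈ Set.Ioo 0 π)
    (h₁ : p * cos s₁ = q * cos (3 * s₁ + c)) (h₂ : p * cos s₂ = q * cos (3 * s₂ + c)) :
    s₁ = s₂ := by
  by_contra hne
  obtain ⟨σ, d, rfl, rfl⟩ : ∃ σ d, s₁ = σ + d ∧ s₂ = σ - d :=
    ⟨(s₁ + s₂) / 2, (s₁ - s₂) / 2, by ring, by ring⟩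
  obtain ⟨hl₁, hu₁⟩ := hs₁
  obtain ⟨hl₂, hu₂⟩ := hs₂
  have hσ : 0 < sin σ := sin_pos_of_pos_of_lt_pi (by linarith) (by linarith)
  have hcd : 0 < cos d := cos_pos_of_mem_Ioo ⟨by linarith, by linarith⟩
  have hd : sin d ≠ 0 := by
    intro h0
    have := (sin_eq_zero_iff_of_lt_of_lt (by linarith) (by linarith)).mp h0
    exact hne (by rw [this]; ring)
  rw [show 3 * (σ + d) + c = (3 * σ + c) + 3 * d by ring, cos_add, cos_add,
    cos_three_mul, sin_three_mul] at h₁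
  rw [show 3 * (σ - d) + c = (3 * σ + c) - 3 * d by ring, cos_sub, cos_sub,
    cos_three_mul, sin_three_mul] at h₂
  generalize 3 * σ + c = ψ at h₁ h₂
  have hC : p * cos σ = q * cos ψ * (4 * cos d ^ 2 - 3) :=
    mul_right_cancel₀ hcd.ne' (by linear_combination (h₁ + h₂) / 2)
  have hS : p * sin σ = q * sin ψ * (3 - 4 * sin d ^ 2) :=
    mul_right_cancel₀ hd (by linear_combination (h₂ - h₁) / 2)
  have hp : 0 < p := by linarith
  have hd2 : 0 < sin d ^ 2 := by positivity
  have hψ : 0 < sin ψ ^ 2 := by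
    refine sq_pos_of_ne_zero fun h0 => ?_
    rw [h0] at hS
    nlinarith [mul_pos hp hσ]
  have hd1 := sin_sq_add_cos_sq d
  have hC2 : (4 * cos d ^ 2 - 3) ^ 2 ≤ 9 := by nlinarith [sq_nonneg (cos d)]
  have hS2 : (3 - 4 * sin d ^ 2) ^ 2 < 9 := by nlinarith [sq_nonneg (cos d)]
  have key : p ^ 2 < 9 * q ^ 2 := by
    calc p ^ 2 = (p * cos σ) ^ 2 + (p * sin σ) ^ 2 := by
          linear_combination -p ^ 2 * sin_sq_add_cos_sq σ
      _ = q ^ 2 * (cos ψ ^ 2 * (4 * cos d ^ 2 - 3) ^ 2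
            + sin ψ ^ 2 * (3 - 4 * sin d ^ 2) ^ 2) := by rw [hC, hS]; ring
      _ < q ^ 2 * (cos ψ ^ 2 * 9 + sin ψ ^ 2 * 9) := by
          refine mul_lt_mul_of_pos_left (add_lt_add_of_le_of_lt ?_ ?_) (by positivity) <;> gcongr
      _ = 9 * q ^ 2 := by linear_combination 9 * q ^ 2 * sin_sq_add_cos_sq ψ
  nlinarith

open Real in
lemma exists_cos_eq_cos_three_mul_add {p q : ℝ} (c : ℝ) (hq : 0 < q) (hqp : q < p) :
    ∃ s ∈ Set.Ioo 0 π, p * cos s = q * cos (3 * s + c) := by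
  have hcont : ContinuousOn (fun s => q * cos (3 * s + c) - p * cos s) (Set.Icc 0 π) := by
    fun_prop
  obtain ⟨s, hs, h⟩ := intermediate_value_Ioo pi_pos.le hcont (show (0 : ℝ) ∈ _ from
    ⟨by simp only [cos_zero]; nlinarith [cos_le_one (3 * 0 + c)],
      by simp only [cos_pi]; nlinarith [neg_one_le_cos (3 * π + c)]⟩)
  exact ⟨s, hs, by simp only at h; linarith⟩

open Real in
lemma ellipse_normal_defect (a b φ s : ℝ) :
    a ^ 2 * (b * sin (φ + 2 * s)) * (a * cos φ - a * cos (φ + 2 * s))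
      - b ^ 2 * (a * cos (φ + 2 * s)) * (b * sin φ - b * sin (φ + 2 * s))
      = a * b * sin s * ((a ^ 2 + b ^ 2) * cos s
        - (a ^ 2 - b ^ 2) * cos (3 * s + 2 * φ)) := by
  obtain ⟨m, rfl⟩ : ∃ m, φ = m - s := ⟨φ + s, by ring⟩
  rw [show m - s + 2 * s = m + s by ring,
    show 3 * s + 2 * (m - s) = (m + s) + m by ring, cos_add (m + s) m,
    show cos s = cos ((m + s) - m) by ring_nf, cos_sub (m + s) m]
  have hcos : cos (m - s) - cos (m + s) = 2 * sin m * sin s := by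
    rw [cos_sub, cos_add]; ring
  have hsin : sin (m - s) - sin (m + s) = -2 * cos m * sin s := by
    rw [sin_sub, sin_add]; ring
  linear_combination a ^ 3 * b * sin (m + s) * hcos - b ^ 3 * a * cos (m + s) * hsin

/-- If `a² ≤ 2b²`, then from every point `A = (X, Y)` of the ellipse
`x²/a² + y²/b² = 1` there are exactly 2 feet of normals. -/
theorem stmt_3 (a b : ℝ) (hab : a > b) (hb : b > 0) (h2 : a ^ 2 ≤ 2 * b ^ 2)
    (X Y : ℝ) (hA : X ^ 2 / a ^ 2 + Y ^ 2 / b ^ 2 = 1) :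
    Set.ncard {B : ℝ × ℝ | B.1 ^ 2 / a ^ 2 + B.2 ^ 2 / b ^ 2 = 1 ∧
      a ^ 2 * B.2 * (X - B.1) = b ^ 2 * B.1 * (Y - B.2)} = 2 := by
  have ha : 0 < a := hb.trans hab
  have hparam : ∀ x y φ : ℝ, x ^ 2 / a ^ 2 + y ^ 2 / b ^ 2 = 1 → ∃ s ∈ Set.Ico 0 Real.pi,
      x = a * Real.cos (φ + 2 * s) ∧ y = b * Real.sin (φ + 2 * s) := by
    intro x y φ h
    rw [← div_pow, ← div_pow] at h
    obtain ⟨s, hs, hx, hy⟩ := exists_angle_of_sq_add_sq_eq_one h φ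
    exact ⟨s, hs, by rw [← hx]; field_simp, by rw [← hy]; field_simp⟩
  obtain ⟨φ, rfl, rfl⟩ : ∃ φ, X = a * Real.cos φ ∧ Y = b * Real.sin φ := by
    obtain ⟨s, -, h⟩ := hparam X Y 0 hA
    exact ⟨_, h⟩
  have hq : 0 < a ^ 2 - b ^ 2 := by nlinarith
  obtain ⟨s₀, hs₀, h₀⟩ := exists_cos_eq_cos_three_mul_add (2 * φ) hq
    (show a ^ 2 - b ^ 2 < a ^ 2 + b ^ 2 by nlinarith)
  refine Set.ncard_eq_two.mpr ⟨(a * Real.cos φ, b * Real.sin φ),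
    (a * Real.cos (φ + 2 * s₀), b * Real.sin (φ + 2 * s₀)), ?_, ?_⟩
  · intro h
    obtain ⟨hc, hs⟩ := Prod.mk.inj h
    have hc := mul_left_cancel₀ ha.ne' hc
    have hs := mul_left_cancel₀ hb.ne' hs
    have hone : Real.cos (2 * s₀) = 1 := by
      rw [show 2 * s₀ = (φ + 2 * s₀) - φ by ring, Real.cos_sub, ← hc, ← hs]
      linear_combination Real.sin_sq_add_cos_sq φ
    rw [Real.cos_two_mul, Real.cos_sq'] at hone
    nlinarith [Real.sin_pos_of_mem_Ioo hs₀]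
  · ext ⟨x, y⟩
    simp only [Set.mem_ofPred_eq, Set.mem_insert_iff, Set.mem_singleton_iff, Prod.mk.injEq]
    constructor
    · rintro ⟨hE, hN⟩
      obtain ⟨s, hs, rfl, rfl⟩ := hparam x y φ hE
      rw [← sub_eq_zero, ellipse_normal_defect] at hN
      rcases hs.1.eq_or_lt with rfl | hpos
      · left; simp
      · right
        have hsin := Real.sin_pos_of_mem_Ioo ⟨hpos, hs.2⟩
        have hG := (mul_eq_zero.mp hN).resolve_left (by positivity)
        rw [cos_eq_cos_three_mul_add_unique hq (by linarith) ⟨hpos, hs.2⟩ hs₀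
          (sub_eq_zero.mp hG) h₀]
        exact ⟨rfl, rfl⟩
    · rintro (⟨rfl, rfl⟩ | ⟨rfl, rfl⟩)
      · exact ⟨hA, by ring⟩
      · refine ⟨?_, ?_⟩
        · field_simp
          exact Real.cos_sq_add_sin_sq _
        · rw [← sub_eq_zero, ellipse_normal_defect, h₀, sub_self, mul_zero]
end

section
/- Let a > b > 0 with a² ≥ 2b², and set x₀ = √(a⁴(a²−2b²)³/((a²−b²)(a²+b²)³)) and y₀ = √(b⁴(2a²−b²)³/((a²−b²)(a²+b²)³)). Then each of the four points (±x₀, ±y₀) lies both on the ellipse E (i.e., x₀²/a² + y₀²/b² = 1) and on the astroid (i.e., (a²x₀²)^(1/3) + (b²y₀²)^(1/3) = ((a²−b²)²)^(1/3)). -/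
theorem Real.pow_three_rpow_one_third {u : ℝ} (hu : 0 ≤ u) : (u ^ 3) ^ ((1 : ℝ) / 3) = u := by
  simpa using Real.pow_rpow_inv_natCast hu (three_ne_zero)

/-- For `a² ≥ 2b²`, each of the four points `(±x₀, ±y₀)` lies both on the ellipse
`x²/a² + y²/b² = 1` and on its evolute astroid. -/
theorem stmt_4 (a b : ℝ) (hab : a > b) (hb : b > 0) (h2 : a ^ 2 ≥ 2 * b ^ 2)
    (x₀ y₀ : ℝ)
    (hx₀ : x₀ = Real.sqrt (a ^ 4 * (a ^ 2 - 2 * b ^ 2) ^ 3 /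
      ((a ^ 2 - b ^ 2) * (a ^ 2 + b ^ 2) ^ 3)))
    (hy₀ : y₀ = Real.sqrt (b ^ 4 * (2 * a ^ 2 - b ^ 2) ^ 3 /
      ((a ^ 2 - b ^ 2) * (a ^ 2 + b ^ 2) ^ 3))) :
    ∀ s t : ℝ, (s = 1 ∨ s = -1) → (t = 1 ∨ t = -1) →
      (s * x₀) ^ 2 / a ^ 2 + (t * y₀) ^ 2 / b ^ 2 = 1 ∧
      (a ^ 2 * (s * x₀) ^ 2) ^ ((1 : ℝ) / 3) + (b ^ 2 * (t * y₀) ^ 2) ^ ((1 : ℝ) / 3)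
        = ((a ^ 2 - b ^ 2) ^ 2) ^ ((1 : ℝ) / 3) := by
  intro s t hs ht
  have hs2 : s ^ 2 = 1 := by rcases hs with rfl | rfl <;> norm_num
  have ht2 : t ^ 2 = 1 := by rcases ht with rfl | rfl <;> norm_num
  have ha : 0 < a := hb.trans hab
  have hpq : 0 < a ^ 2 - b ^ 2 := by nlinarith
  have hp2q : 0 ≤ a ^ 2 - 2 * b ^ 2 := by linarith
  have h2pq : 0 ≤ 2 * a ^ 2 - b ^ 2 := by nlinarith
  have hx : x₀ ^ 2 = a ^ 4 * (a ^ 2 - 2 * b ^ 2) ^ 3 /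
      ((a ^ 2 - b ^ 2) * (a ^ 2 + b ^ 2) ^ 3) := by
    rw [hx₀, Real.sq_sqrt (by positivity)]
  have hy : y₀ ^ 2 = b ^ 4 * (2 * a ^ 2 - b ^ 2) ^ 3 /
      ((a ^ 2 - b ^ 2) * (a ^ 2 + b ^ 2) ^ 3) := by
    rw [hy₀, Real.sq_sqrt (by positivity)]
  rw [mul_pow, mul_pow, hs2, ht2, one_mul, one_mul, hx, hy]
  constructor
  · field_simp
    ring
  · obtain ⟨c, hc, hc3⟩ : ∃ c : ℝ, 0 < c ∧ a ^ 2 - b ^ 2 = c ^ 3 :=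
      ⟨(a ^ 2 - b ^ 2) ^ ((3 : ℕ) : ℝ)⁻¹, by positivity,
        (Real.rpow_inv_natCast_pow hpq.le three_ne_zero).symm⟩
    have hX : a ^ 2 * (a ^ 4 * (a ^ 2 - 2 * b ^ 2) ^ 3 / ((a ^ 2 - b ^ 2) * (a ^ 2 + b ^ 2) ^ 3))
        = (a ^ 2 * (a ^ 2 - 2 * b ^ 2) / (c * (a ^ 2 + b ^ 2))) ^ 3 := by
      rw [hc3]
      field_simp
    have hY : b ^ 2 * (b ^ 4 * (2 * a ^ 2 - b ^ 2) ^ 3 / ((a ^ 2 - b ^ 2) * (a ^ 2 + b ^ 2) ^ 3))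
        = (b ^ 2 * (2 * a ^ 2 - b ^ 2) / (c * (a ^ 2 + b ^ 2))) ^ 3 := by
      rw [hc3]
      field_simp
    have hZ : (a ^ 2 - b ^ 2) ^ 2 = (c ^ 2) ^ 3 := by
      rw [hc3]
      ring
    rw [hX, hY, hZ, Real.pow_three_rpow_one_third (by positivity),
      Real.pow_three_rpow_one_third (by positivity), Real.pow_three_rpow_one_third (by positivity)]
    field_simp
    linear_combination (a ^ 2 + b ^ 2) * hc3
end

section
/- Let a > b > c > 0 with b² ≥ 2c². Set x₁ = √(a⁴(a²−2c²)³/((a²−c²)(a²+c²)³)), z₁ = √(c⁴(2a²−c²)³/((a²−c²)(a²+c²)³)), x₃ = √(a²(a²−b²)²(2c²−b²)/((a²−c²)(2a²c²−a²b²−b²c²))), and z₃ = √(c²(c²−b²)²(2a²−b²)/((c²−a²)(2a²c²−a²b²−b²c²))). Then the point (x₃, z₃) satisfies both x₃²/a² + z₃²/c² = 1 and a²x₃²/(a²−b²)² + c²z₃²/(b²−c²)² = 1; moreover x₁ ≥ x₃ and z₁ ≤ z₃, with equality in either case if and only if 1/a² + 1/c² = 3/b². -/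
/-- `x₁² - x₃²` in terms of the squared semi-axes is a square times a positive factor. -/
theorem x_sq_sub_x_sq {A B C : ℝ} (hAC : A - C ≠ 0) (hAC' : A + C ≠ 0)
    (hD : 2 * A * C - A * B - B * C ≠ 0) :
    A ^ 2 * (A - 2 * C) ^ 3 / ((A - C) * (A + C) ^ 3) -
      A * (A - B) ^ 2 * (2 * C - B) / ((A - C) * (2 * A * C - A * B - B * C)) =
    A * (2 * A ^ 2 - 2 * A * C + 2 * C ^ 2 - (A + C) * B) /
      ((A - C) * (A + C) ^ 3 * (A * B + B * C - 2 * A * C)) * ((A + C) * B - 3 * A * C) ^ 2 := by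
  have hD' : A * B + B * C - 2 * A * C ≠ 0 := fun h => hD (by linear_combination -h)
  rw [div_sub_div _ _ (by positivity) (by positivity), div_mul_eq_mul_div,
    div_eq_div_iff (by positivity) (by positivity)]
  ring

/-- `z₃² - z₁²` in terms of the squared semi-axes is a square times a positive factor. -/
theorem z_sq_sub_z_sq {A B C : ℝ} (hAC : A - C ≠ 0) (hAC' : A + C ≠ 0)
    (hD : 2 * A * C - A * B - B * C ≠ 0) :
    C * (C - B) ^ 2 * (2 * A - B) / ((C - A) * (2 * A * C - A * B - B * C)) -
      C ^ 2 * (2 * A - C) ^ 3 / ((A - C) * (A + C) ^ 3) =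
    C * (2 * A ^ 2 - 2 * A * C + 2 * C ^ 2 - (A + C) * B) /
      ((A - C) * (A + C) ^ 3 * (A * B + B * C - 2 * A * C)) * ((A + C) * B - 3 * A * C) ^ 2 := by
  have hD' : A * B + B * C - 2 * A * C ≠ 0 := fun h => hD (by linear_combination -h)
  have hCA : C - A ≠ 0 := fun h => hAC (by linear_combination -h)
  rw [div_sub_div _ _ (by positivity) (by positivity), div_mul_eq_mul_div,
    div_eq_div_iff (by positivity) (by positivity)]
  ring

theorem sqrt_le_sqrt_and_eq_iff {u v k q : ℝ} (hu : 0 ≤ u) (hk : 0 < k)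
    (h : v - u = k * q ^ 2) :
    Real.sqrt u ≤ Real.sqrt v ∧ (Real.sqrt u = Real.sqrt v ↔ q = 0) := by
  have huv : u ≤ v := by nlinarith [mul_nonneg hk.le (sq_nonneg q)]
  refine ⟨Real.sqrt_le_sqrt huv, ?_⟩
  rw [Real.sqrt_inj hu (hu.trans huv)]
  constructor
  · rintro rfl
    have : k * q ^ 2 = 0 := by linarith
    simpa [hk.ne'] using this
  · rintro rfl
    linarith


/-- If `b² ≥ 2c²`, the point `(x₃, z₃)` lies on both the ellipse `x²/a² + z²/c² = 1`
and the caustic cross-section ellipse `a²x²/(a²−b²)² + c²z²/(b²−c²)² = 1`; moreover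
`x₁ ≥ x₃` and `z₁ ≤ z₃`, with equality (in either) iff `1/a² + 1/c² = 3/b²`. -/
theorem stmt_6 (a b c : ℝ) (hab : a > b) (hbc : b > c) (hc : c > 0)
    (h2 : b ^ 2 ≥ 2 * c ^ 2)
    (x₁ z₁ x₃ z₃ : ℝ)
    (hx₁ : x₁ = Real.sqrt (a ^ 4 * (a ^ 2 - 2 * c ^ 2) ^ 3 /
      ((a ^ 2 - c ^ 2) * (a ^ 2 + c ^ 2) ^ 3)))
    (hz₁ : z₁ = Real.sqrt (c ^ 4 * (2 * a ^ 2 - c ^ 2) ^ 3 /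
      ((a ^ 2 - c ^ 2) * (a ^ 2 + c ^ 2) ^ 3)))
    (hx₃ : x₃ = Real.sqrt (a ^ 2 * (a ^ 2 - b ^ 2) ^ 2 * (2 * c ^ 2 - b ^ 2) /
      ((a ^ 2 - c ^ 2) * (2 * a ^ 2 * c ^ 2 - a ^ 2 * b ^ 2 - b ^ 2 * c ^ 2))))
    (hz₃ : z₃ = Real.sqrt (c ^ 2 * (c ^ 2 - b ^ 2) ^ 2 * (2 * a ^ 2 - b ^ 2) /
      ((c ^ 2 - a ^ 2) * (2 * a ^ 2 * c ^ 2 - a ^ 2 * b ^ 2 - b ^ 2 * c ^ 2)))) :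
    (x₃ ^ 2 / a ^ 2 + z₃ ^ 2 / c ^ 2 = 1) ∧
    (a ^ 2 * x₃ ^ 2 / (a ^ 2 - b ^ 2) ^ 2 + c ^ 2 * z₃ ^ 2 / (b ^ 2 - c ^ 2) ^ 2 = 1) ∧
    x₁ ≥ x₃ ∧ z₁ ≤ z₃ ∧
    (x₁ = x₃ ↔ 1 / a ^ 2 + 1 / c ^ 2 = 3 / b ^ 2) ∧
    (z₁ = z₃ ↔ 1 / a ^ 2 + 1 / c ^ 2 = 3 / b ^ 2) := by
  have ha : 0 < a := by linarith
  have hb : 0 < b := by linarith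
  have hA : 0 < a ^ 2 := by positivity
  have hB : 0 < b ^ 2 := by positivity
  have hC : 0 < c ^ 2 := by positivity
  have hAB : b ^ 2 < a ^ 2 := by gcongr
  have hBC : c ^ 2 < b ^ 2 := by gcongr
  have hiff : 1 / a ^ 2 + 1 / c ^ 2 = 3 / b ^ 2 ↔
      (a ^ 2 + c ^ 2) * b ^ 2 - 3 * a ^ 2 * c ^ 2 = 0 := by
    rw [div_add_div _ _ hA.ne' hC.ne', div_eq_div_iff (by positivity) hB.ne', ← sub_eq_zero]
    ring_nf
  rw [hiff]
  rw [show a ^ 4 = (a ^ 2) ^ 2 by ring] at hx₁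
  rw [show c ^ 4 = (c ^ 2) ^ 2 by ring] at hz₁
  generalize a ^ 2 = A at *
  generalize b ^ 2 = B at *
  generalize c ^ 2 = C at *
  have hAC : 0 < A - C := by linarith
  have hD : 2 * A * C - A * B - B * C < 0 := by
    nlinarith [mul_nonneg hA.le (sub_nonneg.2 h2), mul_pos hB hC]
  have hL : 0 < 2 * A ^ 2 - 2 * A * C + 2 * C ^ 2 - (A + C) * B := by
    nlinarith [mul_pos (add_pos hA hC) (sub_pos.2 hAB),
      mul_pos hAC (show 0 < A - 2 * C by linarith)]
  have hD' : 0 < A * B + B * C - 2 * A * C := by linarith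
  have hX : 0 ≤ A * (A - B) ^ 2 * (2 * C - B) / ((A - C) * (2 * A * C - A * B - B * C)) :=
    div_nonneg_of_nonpos (mul_nonpos_of_nonneg_of_nonpos (by positivity) (by linarith))
      (mul_nonpos_of_nonneg_of_nonpos hAC.le hD.le)
  have hZ₁ : 0 ≤ C ^ 2 * (2 * A - C) ^ 3 / ((A - C) * (A + C) ^ 3) := by
    have : 0 < 2 * A - C := by linarith
    positivity
  have hZ : 0 ≤ C * (C - B) ^ 2 * (2 * A - B) / ((C - A) * (2 * A * C - A * B - B * C)) :=
    div_nonneg (mul_nonneg (by positivity) (by linarith))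
      (mul_nonneg_of_nonpos_of_nonpos (by linarith) hD.le)
  have hAC₀ : A - C ≠ 0 := hAC.ne'
  have hCA₀ : C - A ≠ 0 := by linarith
  have hAB₀ : A - B ≠ 0 := by linarith
  have hBC₀ : B - C ≠ 0 := by linarith
  have hD₀ := hD.ne
  obtain ⟨hxle, hxeq⟩ := sqrt_le_sqrt_and_eq_iff hX (by positivity)
    (x_sq_sub_x_sq hAC₀ (by positivity) hD₀)
  obtain ⟨hzle, hzeq⟩ := sqrt_le_sqrt_and_eq_iff hZ₁ (by positivity)
    (z_sq_sub_z_sq hAC₀ (by positivity) hD₀)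
  rw [← hx₁, ← hx₃] at hxle hxeq
  rw [← hz₁, ← hz₃] at hzle hzeq
  have hx_sq := congrArg (· ^ 2) hx₃
  simp only [Real.sq_sqrt hX] at hx_sq
  have hz_sq : z₃ ^ 2 = C * (C - B) ^ 2 * (B - 2 * A) /
      ((A - C) * (2 * A * C - A * B - B * C)) := by
    rw [hz₃, Real.sq_sqrt hZ, div_eq_div_iff (by positivity) (by positivity)]
    ring
  obtain ⟨D, hD_eq⟩ : ∃ D, D = 2 * A * C - A * B - B * C := ⟨_, rfl⟩
  rw [← hD_eq] at hx_sq hz_sq hD₀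
  refine ⟨?_, ?_, hxle, hzle, eq_comm.trans hxeq, hzeq⟩
  · rw [hx_sq, hz_sq]
    field_simp
    rw [hD_eq]
    ring
  · rw [hx_sq, hz_sq, show (C - B) ^ 2 = (B - C) ^ 2 by ring]
    field_simp
    rw [hD_eq]
    ring
end

section
/- Let a > b > c > 0 with 2b² ≥ a² ≥ 2c². Set y₄ = √(b²(b²−a²)²(2c²−a²)/((b²−c²)(2b²c²−a²b²−a²c²))) and z₄ = √(c²(c²−a²)²(2b²−a²)/((c²−b²)(2b²c²−a²b²−a²c²))). Then the point (y₄, z₄) satisfies both y₄²/b² + z₄²/c² = 1 and b²y₄²/(a²−b²)² + c²z₄²/(a²−c²)² = 1. Moreover, if in addition b² ≥ 2c² and y₂ = √(b⁴(b²−2c²)³/((b²−c²)(b²+c²)³)), z₂ = √(c⁴(2b²−c²)³/((b²−c²)(b²+c²)³)), then (y₂ ≥ y₄ and z₂ ≤ z₄) holds if and only if 2b⁴ + 2c⁴ − a²b² − a²c² − 2b²c² ≥ 0. -/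
/-- Difference of the squared `y`-coordinates of the two intersection points, in terms of the
squared semi-axes `A`, `B`, `C`. -/
lemma sq_astroid_sub_sq_caustic {A B C : ℝ} (hBC : B - C ≠ 0) (hS : B + C ≠ 0)
    (hD : A * B + A * C - 2 * B * C ≠ 0) :
    B ^ 2 * (B - 2 * C) ^ 3 / ((B - C) * (B + C) ^ 3) -
        B * (A - B) ^ 2 * (A - 2 * C) / ((B - C) * (A * B + A * C - 2 * B * C)) =
      B * (A * (B + C) - 3 * B * C) ^ 2 /
          ((B - C) * (B + C) ^ 3 * (A * B + A * C - 2 * B * C)) *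
        (2 * B ^ 2 + 2 * C ^ 2 - A * B - A * C - 2 * B * C) := by
  generalize hE : A * B + A * C - 2 * B * C = D at hD ⊢
  field_simp
  rw [← hE]
  ring

/-- If `2b² ≥ a² ≥ 2c²`, the point `(y₄, z₄)` lies on both the ellipse
`y²/b² + z²/c² = 1` and the caustic cross-section ellipse
`b²y²/(a²−b²)² + c²z²/(a²−c²)² = 1`; and if moreover `b² ≥ 2c²`, then
`y₂ ≥ y₄ ∧ z₂ ≤ z₄` holds iff `2b⁴ + 2c⁴ − a²b² − a²c² − 2b²c² ≥ 0`. -/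
theorem stmt_7 (a b c : ℝ) (hab : a > b) (hbc : b > c) (hc : c > 0)
    (h1 : 2 * b ^ 2 ≥ a ^ 2) (h2 : a ^ 2 ≥ 2 * c ^ 2)
    (y₄ z₄ : ℝ)
    (hy₄ : y₄ = Real.sqrt (b ^ 2 * (b ^ 2 - a ^ 2) ^ 2 * (2 * c ^ 2 - a ^ 2) /
      ((b ^ 2 - c ^ 2) * (2 * b ^ 2 * c ^ 2 - a ^ 2 * b ^ 2 - a ^ 2 * c ^ 2))))
    (hz₄ : z₄ = Real.sqrt (c ^ 2 * (c ^ 2 - a ^ 2) ^ 2 * (2 * b ^ 2 - a ^ 2) /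
      ((c ^ 2 - b ^ 2) * (2 * b ^ 2 * c ^ 2 - a ^ 2 * b ^ 2 - a ^ 2 * c ^ 2)))) :
    (y₄ ^ 2 / b ^ 2 + z₄ ^ 2 / c ^ 2 = 1) ∧
    (b ^ 2 * y₄ ^ 2 / (a ^ 2 - b ^ 2) ^ 2 + c ^ 2 * z₄ ^ 2 / (a ^ 2 - c ^ 2) ^ 2 = 1) ∧
    (∀ y₂ z₂ : ℝ,
      b ^ 2 ≥ 2 * c ^ 2 →
      y₂ = Real.sqrt (b ^ 4 * (b ^ 2 - 2 * c ^ 2) ^ 3 /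
        ((b ^ 2 - c ^ 2) * (b ^ 2 + c ^ 2) ^ 3)) →
      z₂ = Real.sqrt (c ^ 4 * (2 * b ^ 2 - c ^ 2) ^ 3 /
        ((b ^ 2 - c ^ 2) * (b ^ 2 + c ^ 2) ^ 3)) →
      ((y₂ ≥ y₄ ∧ z₂ ≤ z₄) ↔
        2 * b ^ 4 + 2 * c ^ 4 - a ^ 2 * b ^ 2 - a ^ 2 * c ^ 2 - 2 * b ^ 2 * c ^ 2 ≥ 0)) := by
  have hb : 0 < b := hc.trans hbc
  have hB : 0 < b ^ 2 := by positivity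
  have hC : 0 < c ^ 2 := by positivity
  have hBC : 0 < b ^ 2 - c ^ 2 := by nlinarith
  have hAB : 0 < a ^ 2 - b ^ 2 := by nlinarith
  have hAC : 0 < a ^ 2 - c ^ 2 := by linarith
  have hS : 0 < b ^ 2 + c ^ 2 := by positivity
  have hD : 0 < a ^ 2 * b ^ 2 + a ^ 2 * c ^ 2 - 2 * b ^ 2 * c ^ 2 := by
    nlinarith [mul_pos hAB hC, mul_pos hAC hB]
  have h2C : 0 ≤ a ^ 2 - 2 * c ^ 2 := by linarith
  have h2B : 0 ≤ 2 * b ^ 2 - a ^ 2 := by linarith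
  have hy : y₄ ^ 2 = b ^ 2 * (a ^ 2 - b ^ 2) ^ 2 * (a ^ 2 - 2 * c ^ 2) /
      ((b ^ 2 - c ^ 2) * (a ^ 2 * b ^ 2 + a ^ 2 * c ^ 2 - 2 * b ^ 2 * c ^ 2)) := by
    rw [hy₄, ← Real.sq_sqrt (show 0 ≤ b ^ 2 * (a ^ 2 - b ^ 2) ^ 2 * (a ^ 2 - 2 * c ^ 2) /
      ((b ^ 2 - c ^ 2) * (a ^ 2 * b ^ 2 + a ^ 2 * c ^ 2 - 2 * b ^ 2 * c ^ 2)) by positivity),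
      ← neg_div_neg_eq]
    ring_nf
  have hz : z₄ ^ 2 = c ^ 2 * (a ^ 2 - c ^ 2) ^ 2 * (2 * b ^ 2 - a ^ 2) /
      ((b ^ 2 - c ^ 2) * (a ^ 2 * b ^ 2 + a ^ 2 * c ^ 2 - 2 * b ^ 2 * c ^ 2)) := by
    rw [hz₄, ← Real.sq_sqrt (show 0 ≤ c ^ 2 * (a ^ 2 - c ^ 2) ^ 2 * (2 * b ^ 2 - a ^ 2) /
      ((b ^ 2 - c ^ 2) * (a ^ 2 * b ^ 2 + a ^ 2 * c ^ 2 - 2 * b ^ 2 * c ^ 2)) by positivity)]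
    ring_nf
  have hy0 : 0 ≤ y₄ := hy₄ ▸ Real.sqrt_nonneg _
  have hz0 : 0 ≤ z₄ := hz₄ ▸ Real.sqrt_nonneg _
  have hell : y₄ ^ 2 / b ^ 2 + z₄ ^ 2 / c ^ 2 = 1 := by
    rw [hy, hz]
    generalize hE : a ^ 2 * b ^ 2 + a ^ 2 * c ^ 2 - 2 * b ^ 2 * c ^ 2 = D at hD ⊢
    field_simp
    rw [← hE]
    ring
  refine ⟨hell, ?_, ?_⟩
  · rw [hy, hz]
    generalize hE : a ^ 2 * b ^ 2 + a ^ 2 * c ^ 2 - 2 * b ^ 2 * c ^ 2 = D at hD ⊢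
    field_simp
    rw [← hE]
    ring
  · intro y₂ z₂ h3 hy₂ hz₂
    have hK : 0 ≤ b ^ 2 - 2 * c ^ 2 := by linarith
    have hL : 0 ≤ 2 * b ^ 2 - c ^ 2 := by linarith
    have hy2 : y₂ ^ 2 = (b ^ 2) ^ 2 * (b ^ 2 - 2 * c ^ 2) ^ 3 /
        ((b ^ 2 - c ^ 2) * (b ^ 2 + c ^ 2) ^ 3) := by
      rw [hy₂, Real.sq_sqrt (by positivity)]
      ring
    have hz2 : z₂ ^ 2 = (c ^ 2) ^ 2 * (2 * b ^ 2 - c ^ 2) ^ 3 /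
        ((b ^ 2 - c ^ 2) * (b ^ 2 + c ^ 2) ^ 3) := by
      rw [hz₂, Real.sq_sqrt (by positivity)]
      ring
    have hy20 : 0 ≤ y₂ := hy₂ ▸ Real.sqrt_nonneg _
    have hz20 : 0 ≤ z₂ := hz₂ ▸ Real.sqrt_nonneg _
    have hell2 : y₂ ^ 2 / b ^ 2 + z₂ ^ 2 / c ^ 2 = 1 := by
      rw [hy2, hz2]
      field_simp
      ring
    have hyz : y₄ ≤ y₂ ↔ z₂ ≤ z₄ := by
      rw [← sq_le_sq₀ hy0 hy20, ← sq_le_sq₀ hz20 hz0, ← div_le_div_iff_of_pos_right hB,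
        ← div_le_div_iff_of_pos_right hC (a := z₂ ^ 2)]
      constructor <;> intro h <;> linarith
    have hdiff := sq_astroid_sub_sq_caustic hBC.ne' hS.ne' hD.ne'
    rw [← hy2, ← hy] at hdiff
    have hQ : 0 < a ^ 2 * (b ^ 2 + c ^ 2) - 3 * b ^ 2 * c ^ 2 := by
      nlinarith [mul_pos hAB hC, mul_nonneg h2C hB.le]
    have hcoef : 0 < b ^ 2 * (a ^ 2 * (b ^ 2 + c ^ 2) - 3 * b ^ 2 * c ^ 2) ^ 2 /
        ((b ^ 2 - c ^ 2) * (b ^ 2 + c ^ 2) ^ 3 *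
          (a ^ 2 * b ^ 2 + a ^ 2 * c ^ 2 - 2 * b ^ 2 * c ^ 2)) := by positivity
    rw [ge_iff_le, ← hyz, and_self, ← sq_le_sq₀ hy0 hy20, ← sub_nonneg, hdiff,
      mul_nonneg_iff_of_pos_left hcoef, ge_iff_le]
    ring_nf
end

section
/- Let a > b > c > 0 with a² + c² ≤ 2b². Set y₇ = √((b²−a²)³(2c²−b²−a²)³/(b²(c²−b²)(b²+c²−2a²)³)) and z₇ = √((c²−a²)³(2b²−c²−a²)³/(c²(b²−c²)(b²+c²−2a²)³)). Then: (i) the point (y₇, z₇) satisfies both the astroid equation (b²y₇²)^(1/3) + (c²z₇²)^(1/3) = ((b²−c²)²)^(1/3) and the ellipse equation b²y₇²/(a²−b²)² + c²z₇²/(a²−c²)² = 1; (ii) y₇²/b² + z₇²/c² = 1, < 1, or > 1 according as 2b⁴ + 2c⁴ − a²b² − a²c² − 2b²c² = 0, < 0, or > 0, respectively. -/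
theorem Real.pow_three_rpow_one_third_s10 {x : ℝ} (hx : 0 ≤ x) : (x ^ 3) ^ ((1 : ℝ) / 3) = x := by
  rw [← Real.rpow_natCast, ← Real.rpow_mul hx]
  norm_num

theorem Real.exists_pos_pow_three_eq {x : ℝ} (hx : 0 < x) : ∃ s : ℝ, 0 < s ∧ s ^ 3 = x := by
  refine ⟨x ^ ((1 : ℝ) / 3), Real.rpow_pos_of_pos hx _, ?_⟩
  rw [← Real.rpow_natCast, ← Real.rpow_mul hx.le]
  norm_num

/-- With `p = a² − b²`, `q = b² − c²` and `C = c²`, the difference between `y₇²/b² + z₇²/c²` and `1`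
is a positive multiple of `2b⁴ + 2c⁴ − a²b² − a²c² − 2b²c² = q(q − p) − C(2p + q)`. -/
theorem exists_pos_mul_eq_sub_one {p q C : ℝ} (hp : 0 < p) (hpq : p ≤ q) (hC : 0 < C) :
    ∃ k : ℝ, 0 < k ∧
      p ^ 3 * (p + 2 * q) ^ 3 / ((C + q) ^ 2 * q * (2 * p + q) ^ 3)
        + (p + q) ^ 3 * (q - p) ^ 3 / (C ^ 2 * q * (2 * p + q) ^ 3) - 1
        = k * (q * (q - p) - C * (2 * p + q)) := by
  have hq : 0 < q := hp.trans_le hpq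
  have hr : 0 ≤ q - p := sub_nonneg.2 hpq
  refine ⟨(q * (2 * p + q) ^ 2 * C ^ 3 + 3 * q ^ 2 * (2 * p + q) * (p + q) * C ^ 2
    + 3 * q * (p + q) ^ 3 * (q - p) * C + (p + q) ^ 3 * (q - p) ^ 2 * q)
      / (C ^ 2 * (C + q) ^ 2 * q * (2 * p + q) ^ 3), by positivity, ?_⟩
  have h₁ : C + q ≠ 0 := by positivity
  have h₂ : 2 * p + q ≠ 0 := by positivity
  field_simp
  ring


/-- If `a² + c² ≤ 2b²`, the point `(y₇, z₇)` lies on both the astroid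
`(b²y²)^(1/3) + (c²z²)^(1/3) = ((b²−c²)²)^(1/3)` and the ellipse
`b²y²/(a²−b²)² + c²z²/(a²−c²)² = 1`; and it lies on, inside, or outside the
ellipse `y²/b² + z²/c² = 1` according as `2b⁴ + 2c⁴ − a²b² − a²c² − 2b²c²` is
`= 0`, `< 0`, or `> 0`. -/
theorem stmt_10 (a b c : ℝ) (hab : a > b) (hbc : b > c) (hc : c > 0)
    (h : a ^ 2 + c ^ 2 ≤ 2 * b ^ 2)
    (y₇ z₇ : ℝ)
    (hy₇ : y₇ = Real.sqrt ((b ^ 2 - a ^ 2) ^ 3 * (2 * c ^ 2 - b ^ 2 - a ^ 2) ^ 3 /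
      (b ^ 2 * (c ^ 2 - b ^ 2) * (b ^ 2 + c ^ 2 - 2 * a ^ 2) ^ 3)))
    (hz₇ : z₇ = Real.sqrt ((c ^ 2 - a ^ 2) ^ 3 * (2 * b ^ 2 - c ^ 2 - a ^ 2) ^ 3 /
      (c ^ 2 * (b ^ 2 - c ^ 2) * (b ^ 2 + c ^ 2 - 2 * a ^ 2) ^ 3))) :
    ((b ^ 2 * y₇ ^ 2) ^ ((1 : ℝ) / 3) + (c ^ 2 * z₇ ^ 2) ^ ((1 : ℝ) / 3)
      = ((b ^ 2 - c ^ 2) ^ 2) ^ ((1 : ℝ) / 3)) ∧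
    (b ^ 2 * y₇ ^ 2 / (a ^ 2 - b ^ 2) ^ 2 + c ^ 2 * z₇ ^ 2 / (a ^ 2 - c ^ 2) ^ 2 = 1) ∧
    ((2 * b ^ 4 + 2 * c ^ 4 - a ^ 2 * b ^ 2 - a ^ 2 * c ^ 2 - 2 * b ^ 2 * c ^ 2 = 0 →
        y₇ ^ 2 / b ^ 2 + z₇ ^ 2 / c ^ 2 = 1) ∧
     (2 * b ^ 4 + 2 * c ^ 4 - a ^ 2 * b ^ 2 - a ^ 2 * c ^ 2 - 2 * b ^ 2 * c ^ 2 < 0 →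
        y₇ ^ 2 / b ^ 2 + z₇ ^ 2 / c ^ 2 < 1) ∧
     (2 * b ^ 4 + 2 * c ^ 4 - a ^ 2 * b ^ 2 - a ^ 2 * c ^ 2 - 2 * b ^ 2 * c ^ 2 > 0 →
        y₇ ^ 2 / b ^ 2 + z₇ ^ 2 / c ^ 2 > 1)) := by
  obtain ⟨p, hp⟩ : ∃ p, p = a ^ 2 - b ^ 2 := ⟨_, rfl⟩
  obtain ⟨q, hq⟩ : ∃ q, q = b ^ 2 - c ^ 2 := ⟨_, rfl⟩
  have hp0 : 0 < p := by rw [hp]; nlinarith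
  have hq0 : 0 < q := by rw [hq]; nlinarith
  have hpq : p ≤ q := by linarith
  have hr : 0 ≤ q - p := sub_nonneg.2 hpq
  have hb0 : 0 < b := hc.trans hbc
  have hD : 2 * p + q ≠ 0 := by positivity
  have hu : p + q ≠ 0 := by positivity
  have hy : y₇ ^ 2 = p ^ 3 * (p + 2 * q) ^ 3 / (b ^ 2 * q * (2 * p + q) ^ 3) := by
    have e : (b ^ 2 - a ^ 2) ^ 3 * (2 * c ^ 2 - b ^ 2 - a ^ 2) ^ 3 /
        (b ^ 2 * (c ^ 2 - b ^ 2) * (b ^ 2 + c ^ 2 - 2 * a ^ 2) ^ 3)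
        = p ^ 3 * (p + 2 * q) ^ 3 / (b ^ 2 * q * (2 * p + q) ^ 3) := by
      rw [hp, hq]; congr 1 <;> ring
    rw [hy₇, e, Real.sq_sqrt (by positivity)]
  have hz : z₇ ^ 2 = (p + q) ^ 3 * (q - p) ^ 3 / (c ^ 2 * q * (2 * p + q) ^ 3) := by
    have e : (c ^ 2 - a ^ 2) ^ 3 * (2 * b ^ 2 - c ^ 2 - a ^ 2) ^ 3 /
        (c ^ 2 * (b ^ 2 - c ^ 2) * (b ^ 2 + c ^ 2 - 2 * a ^ 2) ^ 3)
        = (p + q) ^ 3 * (q - p) ^ 3 / (c ^ 2 * q * (2 * p + q) ^ 3) := by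
      rw [← neg_div_neg_eq, hp, hq]; congr 1 <;> ring
    rw [hz₇, e, Real.sq_sqrt (by positivity)]
  refine ⟨?_, ?_, ?_⟩
  · obtain ⟨s, hs, hsq⟩ := Real.exists_pos_pow_three_eq hq0
    have ey : b ^ 2 * y₇ ^ 2 = (p * (p + 2 * q) / (s * (2 * p + q))) ^ 3 := by
      rw [hy, div_pow, mul_pow s, hsq]; field_simp
    have ez : c ^ 2 * z₇ ^ 2 = ((p + q) * (q - p) / (s * (2 * p + q))) ^ 3 := by
      rw [hz, div_pow, mul_pow s, hsq]; field_simp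
    have eq' : (b ^ 2 - c ^ 2) ^ 2 = (s ^ 2) ^ 3 := by rw [← hq, ← hsq]; ring
    rw [ey, ez, eq', Real.pow_three_rpow_one_third_s10 (by positivity),
      Real.pow_three_rpow_one_third_s10 (by positivity), Real.pow_three_rpow_one_third_s10 (by positivity),
      ← add_div, div_eq_iff (by positivity)]
    linear_combination -(2 * p + q) * hsq
  · rw [hy, hz, ← hp, show a ^ 2 - c ^ 2 = p + q by rw [hp, hq]; ring]
    field_simp
    ring
  · obtain ⟨k, hk, e⟩ := exists_pos_mul_eq_sub_one hp0 hpq (pow_pos hc 2)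
    have hval : y₇ ^ 2 / b ^ 2 + z₇ ^ 2 / c ^ 2 - 1 = k * (2 * b ^ 4 + 2 * c ^ 4
        - a ^ 2 * b ^ 2 - a ^ 2 * c ^ 2 - 2 * b ^ 2 * c ^ 2) := by
      rw [show 2 * b ^ 4 + 2 * c ^ 4 - a ^ 2 * b ^ 2 - a ^ 2 * c ^ 2 - 2 * b ^ 2 * c ^ 2
        = q * (q - p) - c ^ 2 * (2 * p + q) by rw [hp, hq]; ring, ← e, hy, hz,
        show c ^ 2 + q = b ^ 2 by rw [hq]; ring]
      field_simp
    refine ⟨fun hT ↦ ?_, fun hT ↦ ?_, fun hT ↦ ?_⟩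
    · rw [hT, mul_zero] at hval
      linarith
    · linarith [mul_neg_of_pos_of_neg hk hT]
    · linarith [mul_pos hk hT]
end

section
/- Let a > b > c > 0. If b² ≥ 2c² and 2b⁴ + 2c⁴ − a²b² − a²c² − 2b²c² ≥ 0, then 1/a² + 1/c² > 3/b². -/
/-- If `b² ≥ 2c²` and `2b⁴ + 2c⁴ − a²b² − a²c² − 2b²c² ≥ 0`, then
`1/a² + 1/c² > 3/b²`. -/
theorem stmt_11 (a b c : ℝ) (hab : a > b) (hbc : b > c) (hc : c > 0)
    (h1 : b ^ 2 ≥ 2 * c ^ 2)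
    (h2 : 2 * b ^ 4 + 2 * c ^ 4 - a ^ 2 * b ^ 2 - a ^ 2 * c ^ 2 - 2 * b ^ 2 * c ^ 2 ≥ 0) :
    1 / a ^ 2 + 1 / c ^ 2 > 3 / b ^ 2 := by
  have hb : 0 < b := hc.trans hbc
  have ha : 0 < a := hb.trans hab
  have hAB : b ^ 2 < a ^ 2 := by gcongr
  have hA : 0 < a ^ 2 := by positivity
  have hB : 0 < b ^ 2 := by positivity
  have hC : 0 < c ^ 2 := by positivity
  have hq : 2 * (b ^ 2) ^ 2 + 2 * (c ^ 2) ^ 2 - a ^ 2 * b ^ 2 - a ^ 2 * c ^ 2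
      - 2 * b ^ 2 * c ^ 2 ≥ 0 := by linarith
  generalize a ^ 2 = A at *
  generalize b ^ 2 = B at *
  generalize c ^ 2 = C at *
  have hBC : 2 * C < B := by
    refine lt_of_le_of_ne h1 fun h => ?_
    subst h
    nlinarith [mul_pos hC (sub_pos.2 hAB)]
  have key : A * (3 * C - B) < B * C := by
    rcases le_or_gt (3 * C) B with h | h
    · nlinarith [mul_pos hB hC, mul_nonneg hA.le (sub_nonneg.2 h)]
    · have hle := mul_nonneg hq (sub_pos.2 h).le
      have hpos : 0 < (B - 2 * C) * (2 * B ^ 2 - 3 * B * C + 3 * C ^ 2) :=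
        mul_pos (sub_pos.2 hBC) (by nlinarith [sq_nonneg (4 * B - 3 * C), mul_pos hC hC])
      refine lt_of_mul_lt_mul_right (a := B + C) ?_ (by positivity)
      linarith
  have hdiff : 1 / A + 1 / C - 3 / B = (B * C - A * (3 * C - B)) / (A * B * C) := by
    field_simp
    ring
  have : 0 < (B * C - A * (3 * C - B)) / (A * B * C) :=
    div_pos (sub_pos.2 key) (by positivity)
  linarith
end

section
/- Let a > b > c > 0 with a² < 2c². Then no point (X,Y,Z) ∈ ℝ³ lies on both the ellipsoid and its caustic; that is, there is no (X,Y,Z) with X²/a² + Y²/b² + Z²/c² = 1 for which there exists t ∈ ℝ with t ∉ {−a², −b², −c²}, (aX/(a²+t))² + (bY/(b²+t))² + (cZ/(c²+t))² = 1, and a²X²/(a²+t)³ + b²Y²/(b²+t)³ + c²Z²/(c²+t)³ = 0. -/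
/-- For `-2a² < t < 0`, each term of the first caustic equation dominates the corresponding term
of the ellipsoid equation, strictly so unless the coordinate vanishes. -/
lemma sq_div_sq_lt_of_neg_shift {a t X : ℝ} (ha : 0 < a) (ht : t < 0) (ht' : -(2 * a ^ 2) < t)
    (hne : t ≠ -a ^ 2) (hX : X ≠ 0) : X ^ 2 / a ^ 2 < (a * X / (a ^ 2 + t)) ^ 2 := by
  have hs : a ^ 2 + t ≠ 0 := fun h => hne (by linarith)
  have hX2 : 0 < X ^ 2 := by positivity
  have hs2 : 0 < (a ^ 2 + t) ^ 2 := by positivity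
  have hlt : (a ^ 2 + t) ^ 2 < a ^ 2 * a ^ 2 := by nlinarith
  rw [div_pow, div_lt_div_iff₀ (by positivity) hs2]
  nlinarith [mul_lt_mul_of_pos_left hlt hX2]

lemma sq_div_sq_le_of_neg_shift {a t : ℝ} (X : ℝ) (ha : 0 < a) (ht : t < 0)
    (ht' : -(2 * a ^ 2) < t) (hne : t ≠ -a ^ 2) :
    X ^ 2 / a ^ 2 ≤ (a * X / (a ^ 2 + t)) ^ 2 := by
  rcases eq_or_ne X 0 with rfl | hX
  · simp
  · exact (sq_div_sq_lt_of_neg_shift ha ht ht' hne hX).le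

/-- A vanishing sum of three terms of one sign forces the numerators to vanish. -/
lemma eq_zero_of_sum_div_cube_eq_zero {a b c X Y Z p q r : ℝ} (ha : 0 < a) (hb : 0 < b)
    (hc : 0 < c) (hp : 0 < p) (hq : 0 < q) (hr : 0 < r)
    (h : a ^ 2 * X ^ 2 / p ^ 3 + b ^ 2 * Y ^ 2 / q ^ 3 + c ^ 2 * Z ^ 2 / r ^ 3 = 0) :
    X = 0 ∧ Y = 0 ∧ Z = 0 := by
  have h₁ : 0 ≤ a ^ 2 * X ^ 2 / p ^ 3 := by positivity
  have h₂ : 0 ≤ b ^ 2 * Y ^ 2 / q ^ 3 := by positivity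
  have h₃ : 0 ≤ c ^ 2 * Z ^ 2 / r ^ 3 := by positivity
  have hX : a ^ 2 * X ^ 2 / p ^ 3 = 0 := by linarith
  have hY : b ^ 2 * Y ^ 2 / q ^ 3 = 0 := by linarith
  have hZ : c ^ 2 * Z ^ 2 / r ^ 3 = 0 := by linarith
  simp_all [ha.ne', hb.ne', hc.ne', hp.ne', hq.ne', hr.ne']

/-- If `a² < 2c²`, then the ellipsoid `x²/a² + y²/b² + z²/c² = 1` does not meet its
caustic (centro-surface), given by the parametric equations (4) and (5). -/
theorem stmt_14 (a b c : ℝ) (hab : a > b) (hbc : b > c) (hc : c > 0)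
    (h : a ^ 2 < 2 * c ^ 2) :
    ¬ ∃ X Y Z t : ℝ,
      X ^ 2 / a ^ 2 + Y ^ 2 / b ^ 2 + Z ^ 2 / c ^ 2 = 1 ∧
      t ≠ -a ^ 2 ∧ t ≠ -b ^ 2 ∧ t ≠ -c ^ 2 ∧
      (a * X / (a ^ 2 + t)) ^ 2 + (b * Y / (b ^ 2 + t)) ^ 2 +
        (c * Z / (c ^ 2 + t)) ^ 2 = 1 ∧
      a ^ 2 * X ^ 2 / (a ^ 2 + t) ^ 3 + b ^ 2 * Y ^ 2 / (b ^ 2 + t) ^ 3 +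
        c ^ 2 * Z ^ 2 / (c ^ 2 + t) ^ 3 = 0 := by
  rintro ⟨X, Y, Z, t, hE, hta, htb, htc, h₁, h₂⟩
  have hb : 0 < b := hc.trans hbc
  have ha : 0 < a := hb.trans hab
  have hBC : c ^ 2 < b ^ 2 := by gcongr
  have hAB : b ^ 2 < a ^ 2 := by gcongr
  have hC : 0 < c ^ 2 := by positivity
  have hnz : ¬ (X = 0 ∧ Y = 0 ∧ Z = 0) := by
    rintro ⟨rfl, rfl, rfl⟩
    norm_num at hE
  have ht : t < 0 := by
    by_contra! ht
    exact hnz (eq_zero_of_sum_div_cube_eq_zero ha hb hc (by linarith) (by linarith)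
      (by linarith) h₂)
  have htA : -a ^ 2 ≤ t := by
    by_contra! htA
    refine hnz (eq_zero_of_sum_div_cube_eq_zero (p := -(a ^ 2 + t)) (q := -(b ^ 2 + t))
      (r := -(c ^ 2 + t)) ha hb hc (by linarith) (by linarith) (by linarith) ?_)
    simp only [Odd.neg_pow (by decide : Odd 3), div_neg]
    linarith
  have hX := sq_div_sq_le_of_neg_shift X ha ht (by linarith) hta
  have hY := sq_div_sq_le_of_neg_shift Y hb ht (by linarith) htb
  have hZ := sq_div_sq_le_of_neg_shift Z hc ht (by linarith) htc
  refine hnz ⟨?_, ?_, ?_⟩ <;> by_contra hne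
  · linarith [sq_div_sq_lt_of_neg_shift ha ht (by linarith) hta hne]
  · linarith [sq_div_sq_lt_of_neg_shift hb ht (by linarith) htb hne]
  · linarith [sq_div_sq_lt_of_neg_shift hc ht (by linarith) htc hne]
end

section
/- Let a > b > c > 0 with a² > 2c². Then the ellipsoid and its caustic intersect: there exists a point (X,Y,Z) ∈ ℝ³ with X²/a² + Y²/b² + Z²/c² = 1 and a parameter t ∈ ℝ with t ∉ {−a², −b², −c²} such that (aX/(a²+t))² + (bY/(b²+t))² + (cZ/(c²+t))² = 1 and a²X²/(a²+t)³ + b²Y²/(b²+t)³ + c²Z²/(c²+t)³ = 0. -/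
/-- The caustic equations are linear in the normalized squares
`u = X² / a²`, `v = Y² / b²`, `w = Z² / c²`, so a nonnegative solution in these
quantities yields a point. -/
lemma exists_point_of_squares {a b c u v w t : ℝ} (ha : 0 < a) (hb : 0 < b) (hc : 0 < c)
    (hu : 0 ≤ u) (hv : 0 ≤ v) (hw : 0 ≤ w) (hsum : u + v + w = 1)
    (hta : t ≠ -a ^ 2) (htb : t ≠ -b ^ 2) (htc : t ≠ -c ^ 2)
    (h₁ : (a ^ 2) ^ 2 * u / (a ^ 2 + t) ^ 2 + (b ^ 2) ^ 2 * v / (b ^ 2 + t) ^ 2 +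
      (c ^ 2) ^ 2 * w / (c ^ 2 + t) ^ 2 = 1)
    (h₂ : (a ^ 2) ^ 2 * u / (a ^ 2 + t) ^ 3 + (b ^ 2) ^ 2 * v / (b ^ 2 + t) ^ 3 +
      (c ^ 2) ^ 2 * w / (c ^ 2 + t) ^ 3 = 0) :
    ∃ X Y Z t : ℝ,
      X ^ 2 / a ^ 2 + Y ^ 2 / b ^ 2 + Z ^ 2 / c ^ 2 = 1 ∧
      t ≠ -a ^ 2 ∧ t ≠ -b ^ 2 ∧ t ≠ -c ^ 2 ∧
      (a * X / (a ^ 2 + t)) ^ 2 + (b * Y / (b ^ 2 + t)) ^ 2 +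
        (c * Z / (c ^ 2 + t)) ^ 2 = 1 ∧
      a ^ 2 * X ^ 2 / (a ^ 2 + t) ^ 3 + b ^ 2 * Y ^ 2 / (b ^ 2 + t) ^ 3 +
        c ^ 2 * Z ^ 2 / (c ^ 2 + t) ^ 3 = 0 := by
  refine ⟨a * √u, b * √v, c * √w, t, ?_, hta, htb, htc, ?_, ?_⟩
  · simp only [mul_pow, Real.sq_sqrt hu, Real.sq_sqrt hv, Real.sq_sqrt hw]
    field_simp
    exact hsum
  · rw [← h₁]
    simp only [mul_pow, div_pow, Real.sq_sqrt hu, Real.sq_sqrt hv, Real.sq_sqrt hw]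
    ring
  · rw [← h₂]
    simp only [mul_pow, Real.sq_sqrt hu, Real.sq_sqrt hv, Real.sq_sqrt hw]
    ring

/-- The solution of the two caustic equations lying in a coordinate plane, with the value of
its ellipsoid equation. -/
lemma planar_caustic {A C t : ℝ} (hC : 0 < C) (hCA : C < A)
    (htA : -A < t) (htC : t < -C) :
    ∃ u w : ℝ, 0 ≤ u ∧ 0 ≤ w ∧
      A ^ 2 * u / (A + t) ^ 2 + C ^ 2 * w / (C + t) ^ 2 = 1 ∧
      A ^ 2 * u / (A + t) ^ 3 + C ^ 2 * w / (C + t) ^ 3 = 0 ∧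
      u + w = 1 - t ^ 2 * (3 * A * C + (A + C) * t) / (A ^ 2 * C ^ 2) := by
  have hA : 0 < A := hC.trans hCA
  have hd : 0 < A - C := by linarith
  have hAt : 0 < A + t := by linarith
  have hCt : 0 < -(C + t) := by linarith
  have hd' := hd.ne'
  have hAt' := hAt.ne'
  have hCt' : C + t ≠ 0 := by linarith
  refine ⟨(A + t) ^ 3 / (A ^ 2 * (A - C)), (-(C + t)) ^ 3 / (C ^ 2 * (A - C)),
    by positivity, by positivity, ?_, ?_, ?_⟩
  · field_simp
    ring
  · field_simp
    ring
  · field_simp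
    ring

/-- If `a² > 2c²`, then the ellipsoid `x²/a² + y²/b² + z²/c² = 1` intersects its
caustic (centro-surface), given by the parametric equations (4) and (5). -/
theorem stmt_15 (a b c : ℝ) (hab : a > b) (hbc : b > c) (hc : c > 0)
    (h : a ^ 2 > 2 * c ^ 2) :
    ∃ X Y Z t : ℝ,
      X ^ 2 / a ^ 2 + Y ^ 2 / b ^ 2 + Z ^ 2 / c ^ 2 = 1 ∧
      t ≠ -a ^ 2 ∧ t ≠ -b ^ 2 ∧ t ≠ -c ^ 2 ∧
      (a * X / (a ^ 2 + t)) ^ 2 + (b * Y / (b ^ 2 + t)) ^ 2 +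
        (c * Z / (c ^ 2 + t)) ^ 2 = 1 ∧
      a ^ 2 * X ^ 2 / (a ^ 2 + t) ^ 3 + b ^ 2 * Y ^ 2 / (b ^ 2 + t) ^ 3 +
        c ^ 2 * Z ^ 2 / (c ^ 2 + t) ^ 3 = 0 := by
  have hb : 0 < b := hc.trans hbc
  have ha : 0 < a := hb.trans hab
  have hBA : b ^ 2 < a ^ 2 := by gcongr
  have hCB : c ^ 2 < b ^ 2 := by gcongr
  have hC : 0 < c ^ 2 := by positivity
  have main := @exists_point_of_squares a b c
  generalize a ^ 2 = A at *
  generalize b ^ 2 = B at *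
  generalize c ^ 2 = C at *
  have hB : 0 < B := hC.trans hCB
  have hA : 0 < A := hB.trans hBA
  have hs : 0 < A + C := by positivity
  by_cases hBs : B = 3 * A * C / (A + C)
  · obtain ⟨s, hs₁, hs₂⟩ : ∃ s, B < s ∧ s < min A (3 * A * B / (A + B)) := by
      refine exists_between (lt_min hBA ?_)
      have hBA2 : B < 2 * A := by linarith
      rw [lt_div_iff₀ (by positivity)]
      nlinarith
    obtain ⟨hsA, hsB⟩ := lt_min_iff.mp hs₂
    rw [lt_div_iff₀ (by positivity)] at hsB
    rw [eq_div_iff hs.ne'] at hBs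
    have hs0 : 0 < s := hB.trans hs₁
    obtain ⟨u₁, w₁, hu₁, hw₁, e₁, f₁, g₁⟩ := @planar_caustic A C (-s) hC (by linarith)
      (by linarith) (by linarith)
    obtain ⟨u₂, v₂, hu₂, hv₂, e₂, f₂, g₂⟩ := @planar_caustic A B (-s) hB hBA
      (by linarith) (by linarith)
    have k₁ : 1 < u₁ + w₁ := by
      have : 0 < (-s) ^ 2 * ((A + C) * s - 3 * A * C) / (A ^ 2 * C ^ 2) := by
        have : 0 < (A + C) * s - 3 * A * C := by nlinarith
        rw [neg_sq]
        positivity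
      rw [g₁]
      linear_combination this
    have k₂ : u₂ + v₂ < 1 := by
      have : 0 < (-s) ^ 2 * (3 * A * B + (A + B) * -s) / (A ^ 2 * B ^ 2) := by
        have : 0 < 3 * A * B + (A + B) * -s := by linarith
        rw [neg_sq]
        positivity
      linarith
    obtain ⟨l, m, hl, hm, hlm, hS⟩ : ∃ l m : ℝ, 0 ≤ l ∧ 0 ≤ m ∧ l + m = 1 ∧
        l * (u₁ + w₁) + m * (u₂ + v₂) = 1 := by
      have hd : 0 < (u₁ + w₁) - (u₂ + v₂) := by linarith
      have p₁ : 0 ≤ 1 - (u₂ + v₂) := by linarith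
      have p₂ : 0 ≤ (u₁ + w₁) - 1 := by linarith
      refine ⟨_, _, div_nonneg p₁ hd.le, div_nonneg p₂ hd.le, ?_, ?_⟩
      · field_simp
        ring
      · field_simp
        ring
    refine main (u := l * u₁ + m * u₂) (v := m * v₂) (w := l * w₁) (t := -s) ha hb hc
      (by positivity) (by positivity) (by positivity) (by linarith) (by linarith)
      (by linarith) (by linarith) ?_ ?_
    · linear_combination l * e₁ + m * e₂ + hlm
    · linear_combination l * f₁ + m * f₂
  · have hlt : 3 * A * C / (A + C) < A := by
      rw [div_lt_iff₀ hs]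
      nlinarith
    have hgt : C < 3 * A * C / (A + C) := by
      rw [lt_div_iff₀ hs]
      nlinarith
    have hr : (A + C) * (3 * A * C / (A + C)) = 3 * A * C := by field_simp
    generalize 3 * A * C / (A + C) = s at *
    obtain ⟨u, w, hu, hw, e, f, g⟩ := @planar_caustic A C (-s) hC (by linarith)
      (by linarith) (by linarith)
    have hg : 3 * A * C + (A + C) * -s = 0 := by linarith
    rw [hg, mul_zero, zero_div, sub_zero] at g
    refine main (u := u) (v := 0) (w := w) (t := -s) ha hb hc hu le_rfl hw (by linarith)
      (by intro h'; linarith) (fun h' => hBs (by linarith)) (by intro h'; linarith) ?_ ?_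
    · linear_combination e
    · linear_combination f
end

section
/- Let a > b > c > 0 and set α = b²−c², β = c²−a², γ = a²−b², Ω = α²−βγ. Define the rational functions X(t) = ((γ−α)t+α)((γ−α)t−2γ)²((β−γ)t+γ)³ / (−βγa²(αγ+Ωt)(3t−2)²), Y(t) = t²(t−1)((γ−α)²t+3αγ)³ / (−αγb²(αγ+Ωt)(3t−2)²), Z(t) = ((γ−α)t−γ)((γ−α)t+2α)²((α−β)t−α)³ / (−αβc²(αγ+Ωt)(3t−2)²) (these are the squares x(t)², y(t)², z(t)² of Cayley's parametrization of the nodal curve of the caustic). Then for every t ∈ ℝ with 3t−2 ≠ 0, αγ+Ωt ≠ 0, and r(t) ≠ 0, one has X(t)/a² + Y(t)/b² + Z(t)/c² − 1 = p(t)·q(t)² / (a⁴b⁴c⁴(3t−2)²·r(t)), where p(t) = (a⁴b² + a⁴c² + a²b⁴ + a²c⁴ + b⁴c² + b²c⁴ − 6a²b²c²)(a² − 2b² + c²)t² + (11a⁴b²c² + 11a²b²c⁴ + 3a²b⁶ + 3b⁶c² − a⁶b² − a⁶c² − a²c⁶ − b²c⁶ − a⁴b⁴ − 5a⁴c⁴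 − b⁴c⁴ − 17a²b⁴c²)t + (a²−b²)(b²−c²)(a²b² + b²c² − 3a²c²), q(t) = (a²+b²+c²)(a²−2b²+c²)t² + (4b⁴ + a²b² + b²c² − 3a²c²)t − 2b⁴, and r(t) = (a⁴+b⁴+c⁴−a²b²−b²c²−a²c²)t + (a²−b²)(b²−c²). -/
/-- Three fractions sharing the denominator `D * s ^ 2` are combined once the identity with
cleared denominators is known. -/
lemma sum_div_sub_one_eq_of_cleared {a b c α β γ D s L M N P : ℝ} (ha : a ≠ 0) (hb : b ≠ 0)
    (hc : c ≠ 0) (hα : α ≠ 0) (hβ : β ≠ 0) (hγ : γ ≠ 0) (hD : D ≠ 0) (hs : s ≠ 0)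
    (h : -(L * α * b ^ 4 * c ^ 4 + M * β * a ^ 4 * c ^ 4 + N * γ * a ^ 4 * b ^ 4) -
      α * β * γ * a ^ 4 * b ^ 4 * c ^ 4 * D * s ^ 2 = α * β * γ * P) :
    L / (-β * γ * a ^ 2 * D * s ^ 2) / a ^ 2 + M / (-α * γ * b ^ 2 * D * s ^ 2) / b ^ 2 +
      N / (-α * β * c ^ 2 * D * s ^ 2) / c ^ 2 - 1 = P / (a ^ 4 * b ^ 4 * c ^ 4 * s ^ 2 * D) := by
  have hP : P = (-(L * α * b ^ 4 * c ^ 4 + M * β * a ^ 4 * c ^ 4 + N * γ * a ^ 4 * b ^ 4) -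
      α * β * γ * a ^ 4 * b ^ 4 * c ^ 4 * D * s ^ 2) / (α * β * γ) := by
    rw [h]; field_simp
  rw [hP]
  field_simp
  ring

/-- The key algebraic identity for Cayley's parametrization of the nodal curve of
the caustic of the ellipsoid: `X(t)/a² + Y(t)/b² + Z(t)/c² − 1 = p(t)q(t)²/(a⁴b⁴c⁴(3t−2)²r(t))`. -/
theorem stmt_16 (a b c : ℝ) (hab : a > b) (hbc : b > c) (hc : c > 0)
    (α β γ Ω : ℝ)
    (hα : α = b ^ 2 - c ^ 2) (hβ : β = c ^ 2 - a ^ 2) (hγ : γ = a ^ 2 - b ^ 2)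
    (hΩ : Ω = α ^ 2 - β * γ)
    (X Y Z p q r : ℝ → ℝ)
    (hX : ∀ t, X t = ((γ - α) * t + α) * ((γ - α) * t - 2 * γ) ^ 2 *
      ((β - γ) * t + γ) ^ 3 / (-β * γ * a ^ 2 * (α * γ + Ω * t) * (3 * t - 2) ^ 2))
    (hY : ∀ t, Y t = t ^ 2 * (t - 1) * ((γ - α) ^ 2 * t + 3 * α * γ) ^ 3 /
      (-α * γ * b ^ 2 * (α * γ + Ω * t) * (3 * t - 2) ^ 2))
    (hZ : ∀ t, Z t = ((γ - α) * t - γ) * ((γ - α) * t + 2 * α) ^ 2 *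
      ((α - β) * t - α) ^ 3 / (-α * β * c ^ 2 * (α * γ + Ω * t) * (3 * t - 2) ^ 2))
    (hp : ∀ t, p t =
      (a ^ 4 * b ^ 2 + a ^ 4 * c ^ 2 + a ^ 2 * b ^ 4 + a ^ 2 * c ^ 4 + b ^ 4 * c ^ 2 +
          b ^ 2 * c ^ 4 - 6 * a ^ 2 * b ^ 2 * c ^ 2) *
        (a ^ 2 - 2 * b ^ 2 + c ^ 2) * t ^ 2 +
      (11 * a ^ 4 * b ^ 2 * c ^ 2 + 11 * a ^ 2 * b ^ 2 * c ^ 4 + 3 * a ^ 2 * b ^ 6 +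
          3 * b ^ 6 * c ^ 2 - a ^ 6 * b ^ 2 - a ^ 6 * c ^ 2 - a ^ 2 * c ^ 6 -
          b ^ 2 * c ^ 6 - a ^ 4 * b ^ 4 - 5 * a ^ 4 * c ^ 4 - b ^ 4 * c ^ 4 -
          17 * a ^ 2 * b ^ 4 * c ^ 2) * t +
      (a ^ 2 - b ^ 2) * (b ^ 2 - c ^ 2) * (a ^ 2 * b ^ 2 + b ^ 2 * c ^ 2 - 3 * a ^ 2 * c ^ 2))
    (hq : ∀ t, q t =
      (a ^ 2 + b ^ 2 + c ^ 2) * (a ^ 2 - 2 * b ^ 2 + c ^ 2) * t ^ 2 +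
      (4 * b ^ 4 + a ^ 2 * b ^ 2 + b ^ 2 * c ^ 2 - 3 * a ^ 2 * c ^ 2) * t - 2 * b ^ 4)
    (hr : ∀ t, r t =
      (a ^ 4 + b ^ 4 + c ^ 4 - a ^ 2 * b ^ 2 - b ^ 2 * c ^ 2 - a ^ 2 * c ^ 2) * t +
      (a ^ 2 - b ^ 2) * (b ^ 2 - c ^ 2)) :
    ∀ t : ℝ, 3 * t - 2 ≠ 0 → α * γ + Ω * t ≠ 0 → r t ≠ 0 →
      X t / a ^ 2 + Y t / b ^ 2 + Z t / c ^ 2 - 1 =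
        p t * (q t) ^ 2 / (a ^ 4 * b ^ 4 * c ^ 4 * (3 * t - 2) ^ 2 * r t) := by
  intro t ht hD _
  have hα0 : α ≠ 0 := by rw [hα]; nlinarith
  have hβ0 : β ≠ 0 := by rw [hβ]; nlinarith
  have hγ0 : γ ≠ 0 := by rw [hγ]; nlinarith
  have hrD : r t = α * γ + Ω * t := by rw [hr, hΩ, hα, hβ, hγ]; ring
  rw [hrD, hX, hY, hZ]
  refine sum_div_sub_one_eq_of_cleared (by linarith) (by linarith) hc.ne' hα0 hβ0 hγ0 hD ht ?_
  rw [hp, hq, hΩ, hα, hβ, hγ]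
  ring
end

section
/- Let a > b > c > 0 satisfy 2b⁴ + 2c⁴ − a²b² − a²c² − 2b²c² ≤ 0 and 1/a² + 1/c² ≥ 3/b². With α = b²−c², β = c²−a², γ = a²−b², Ω = α²−βγ, define X(t), Y(t), Z(t) by Cayley's nodal-curve formulas X(t) = ((γ−α)t+α)((γ−α)t−2γ)²((β−γ)t+γ)³/(−βγa²(αγ+Ωt)(3t−2)²), Y(t) = t²(t−1)((γ−α)²t+3αγ)³/(−αγb²(αγ+Ωt)(3t−2)²), Z(t) = ((γ−α)t−γ)((γ−α)t+2α)²((α−β)t−α)³/(−αβc²(αγ+Ωt)(3t−2)²), and set m = min((b²−c²)/(a²+b²−2c²), (a²−b²)/(2a²−b²−c²)). Then there exists exactly one t₀ ∈ [0, m] with X(t₀)/a² + Y(t₀)/b² + Z(t₀)/c² = 1, and this t₀ satisfies p(t₀) = 0, where p(t) = (a⁴b² + a⁴c² + a²b⁴ + a²c⁴ + b⁴c² + b²c⁴ − 6a²b²c²)(a² − 2b² + c²)t² + (11a⁴b²c² + 11a²b²c⁴ + 3a²b⁶ + 3b⁶c² − a⁶b² − a⁶c² − a²c⁶ − b²c⁶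 − a⁴b⁴ − 5a⁴c⁴ − b⁴c⁴ − 17a²b⁴c²)t + (a²−b²)(b²−c²)(a²b² + b²c² − 3a²c²). -/
/-- The leading coefficient of the quadratic, in terms of
`u = b² - c²`, `v = a² - b²`, `w = c²`. -/
def nodalQuadA (u v w : ℝ) : ℝ :=
  -2 * u ^ 4 - u ^ 3 * v - 2 * u ^ 3 * w + 2 * u ^ 2 * v ^ 2 + u * v ^ 3 + 2 * v ^ 3 * w

/-- The linear coefficient of the quadratic, in terms of
`u = b² - c²`, `v = a² - b²`, `w = c²`. -/
def nodalQuadB (u v w : ℝ) : ℝ :=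
  u ^ 4 - 2 * u ^ 3 * v - 4 * u ^ 2 * v ^ 2 - 4 * u ^ 2 * v * w - u ^ 2 * w ^ 2 - u * v ^ 3
    - u * v * w ^ 2 - 2 * v ^ 3 * w - v ^ 2 * w ^ 2

/-- The constant coefficient of the quadratic, in terms of
`u = b² - c²`, `v = a² - b²`, `w = c²`. -/
def nodalQuadC (u v w : ℝ) : ℝ :=
  u * v * ((w + u + v) * (w + u) + (w + u) * w - 3 * (w + u + v) * w)

/-- The quartic cofactor of the quadratic in the equation of the intersection of the nodal curve
with the ellipsoid. -/
def nodalQuartic (u v w t : ℝ) : ℝ :=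
  4 * t ^ 4 * u ^ 4 - 4 * t ^ 4 * u ^ 3 * v + 12 * t ^ 4 * u ^ 3 * w - 3 * t ^ 4 * u ^ 2 * v ^ 2
    - 18 * t ^ 4 * u ^ 2 * v * w + 9 * t ^ 4 * u ^ 2 * w ^ 2 + 2 * t ^ 4 * u * v ^ 3
    - 18 * t ^ 4 * u * v * w ^ 2 + t ^ 4 * v ^ 4 + 6 * t ^ 4 * v ^ 3 * w
    + 9 * t ^ 4 * v ^ 2 * w ^ 2 - 20 * t ^ 3 * u ^ 4 + 6 * t ^ 3 * u ^ 3 * v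
    - 62 * t ^ 3 * u ^ 3 * w + 12 * t ^ 3 * u ^ 2 * v ^ 2 + 48 * t ^ 3 * u ^ 2 * v * w
    - 60 * t ^ 3 * u ^ 2 * w ^ 2 + 2 * t ^ 3 * u * v ^ 3 + 18 * t ^ 3 * u * v ^ 2 * w
    + 66 * t ^ 3 * u * v * w ^ 2 - 18 * t ^ 3 * u * w ^ 3 - 4 * t ^ 3 * v ^ 3 * w
    - 6 * t ^ 3 * v ^ 2 * w ^ 2 + 18 * t ^ 3 * v * w ^ 3 + 33 * t ^ 2 * u ^ 4
    + 6 * t ^ 2 * u ^ 3 * v + 108 * t ^ 2 * u ^ 3 * w - 3 * t ^ 2 * u ^ 2 * v ^ 2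
    - 24 * t ^ 2 * u ^ 2 * v * w + 126 * t ^ 2 * u ^ 2 * w ^ 2 - 12 * t ^ 2 * u * v ^ 2 * w
    - 54 * t ^ 2 * u * v * w ^ 2 + 60 * t ^ 2 * u * w ^ 3 - 24 * t ^ 2 * v * w ^ 3
    + 9 * t ^ 2 * w ^ 4 - 20 * t * u ^ 4 - 4 * t * u ^ 3 * v - 72 * t * u ^ 3 * w
    - 96 * t * u ^ 2 * w ^ 2 + 12 * t * u * v * w ^ 2 - 56 * t * u * w ^ 3 + 8 * t * v * w ^ 3
    - 12 * t * w ^ 4 + 4 * u ^ 4 + 16 * u ^ 3 * w + 24 * u ^ 2 * w ^ 2 + 16 * u * w ^ 3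
    + 4 * w ^ 4

theorem nodal_numerator_factor (u v w t : ℝ) :
    u * (w + u) ^ 2 * w ^ 2 * (((v - u) * t + u) * ((v - u) * t - 2 * v) ^ 2 *
        ((-(u + v) - v) * t + v) ^ 3) -
      (u + v) * (w + u + v) ^ 2 * w ^ 2 * (t ^ 2 * (t - 1) * ((v - u) ^ 2 * t + 3 * u * v) ^ 3) +
      v * (w + u + v) ^ 2 * (w + u) ^ 2 * (((v - u) * t - v) * ((v - u) * t + 2 * u) ^ 2 *
        ((u - -(u + v)) * t - u) ^ 3) -
      u * v * (u + v) * ((w + u + v) * (w + u) * w) ^ 2 *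
        ((u * v + (u ^ 2 - -(u + v) * v) * t) * (3 * t - 2) ^ 2) =
    u * v * (u + v) * ((nodalQuadA u v w * t ^ 2 + nodalQuadB u v w * t + nodalQuadC u v w) *
      nodalQuartic u v w t) := by
  unfold nodalQuadA nodalQuadB nodalQuadC nodalQuartic
  ring

theorem div_sum_sub_one {A B C u v s d k N₁ N₂ N₃ R : ℝ} (hA : A ≠ 0) (hB : B ≠ 0) (hC : C ≠ 0)
    (hu : u ≠ 0) (hv : v ≠ 0) (hs : s ≠ 0) (hd : d ≠ 0) (hk : k ≠ 0)
    (h : u * B ^ 2 * C ^ 2 * N₁ - s * A ^ 2 * C ^ 2 * N₂ + v * A ^ 2 * B ^ 2 * N₃ -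
      u * v * s * (A * B * C) ^ 2 * (d * k ^ 2) = u * v * s * R) :
    N₁ / (- -s * v * A * d * k ^ 2) / A + N₂ / (-u * v * B * d * k ^ 2) / B +
      N₃ / (-u * -s * C * d * k ^ 2) / C - 1 = R / ((A * B * C) ^ 2 * (d * k ^ 2)) := by
  have hR : R = (u * B ^ 2 * C ^ 2 * N₁ - s * A ^ 2 * C ^ 2 * N₂ + v * A ^ 2 * B ^ 2 * N₃ -
      u * v * s * (A * B * C) ^ 2 * (d * k ^ 2)) / (u * v * s) := by
    rw [h]; field_simp
  rw [hR]
  field_simp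
  ring

set_option maxHeartbeats 1000000 in
theorem nodalQuartic_pos_of_le {u v w t : ℝ} (hu : 0 < u) (huv : u ≤ v) (hw : 0 < w) (ht : 0 ≤ t)
    (htu : t * (2 * u + v) ≤ u) : 0 < nodalQuartic u v w t := by
  obtain ⟨e, he, rfl⟩ : ∃ e, 0 ≤ e ∧ v = u + e := ⟨v - u, by linarith, by ring⟩
  rcases ht.eq_or_lt with rfl | ht
  · have : nodalQuartic u (u + e) w 0 = 4 * (w + u) ^ 4 := by unfold nodalQuartic; ring
    rw [this]; positivity
  obtain ⟨f, hf, rfl⟩ : ∃ f, 0 ≤ f ∧ t = u / (3 * u + e + f) := by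
    refine ⟨u / t - (3 * u + e), ?_, by rw [add_sub_cancel, div_div_cancel₀ hu.ne']⟩
    rw [sub_nonneg, le_div_iff₀ ht]
    linarith
  have hd : 0 < 3 * u + e + f := by positivity
  have key : nodalQuartic u (u + e) w (u / (3 * u + e + f)) =
      ((36 * u ^ 6 * f ^ 2 + 36 * u ^ 5 * e * f ^ 2 + 24 * u ^ 5 * f ^ 3
        + 9 * u ^ 4 * e ^ 2 * f ^ 2 + 12 * u ^ 4 * e * f ^ 3 + 4 * u ^ 4 * f ^ 4)
        + (216 * u ^ 6 * f + 360 * u ^ 5 * e * f + 288 * u ^ 5 * f ^ 2 + 198 * u ^ 4 * e ^ 2 * f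
        + 312 * u ^ 4 * e * f ^ 2 + 120 * u ^ 4 * f ^ 3 + 36 * u ^ 3 * e ^ 3 * f
        + 84 * u ^ 3 * e ^ 2 * f ^ 2 + 64 * u ^ 3 * e * f ^ 3 + 16 * u ^ 3 * f ^ 4) * w
        + (324 * u ^ 6 + 756 * u ^ 5 * e + 756 * u ^ 5 * f + 657 * u ^ 4 * e ^ 2
        + 1278 * u ^ 4 * e * f + 612 * u ^ 4 * f ^ 2 + 252 * u ^ 3 * e ^ 3
        + 714 * u ^ 3 * e ^ 2 * f + 666 * u ^ 3 * e * f ^ 2 + 204 * u ^ 3 * f ^ 3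
        + 36 * u ^ 2 * e ^ 4 + 132 * u ^ 2 * e ^ 3 * f + 180 * u ^ 2 * e ^ 2 * f ^ 2
        + 108 * u ^ 2 * e * f ^ 3 + 24 * u ^ 2 * f ^ 4) * w ^ 2 + (324 * u ^ 5 + 702 * u ^ 4 * e
        + 648 * u ^ 4 * f + 558 * u ^ 3 * e ^ 2 + 1026 * u ^ 3 * e * f + 468 * u ^ 3 * f ^ 2
        + 192 * u ^ 2 * e ^ 3 + 528 * u ^ 2 * e ^ 2 * f + 480 * u ^ 2 * e * f ^ 2
        + 144 * u ^ 2 * f ^ 3 + 24 * u * e ^ 4 + 88 * u * e ^ 3 * f + 120 * u * e ^ 2 * f ^ 2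
        + 72 * u * e * f ^ 3 + 16 * u * f ^ 4) * w ^ 3 + (81 * u ^ 4 + 162 * u ^ 3 * e
        + 162 * u ^ 3 * f + 117 * u ^ 2 * e ^ 2 + 234 * u ^ 2 * e * f + 117 * u ^ 2 * f ^ 2
        + 36 * u * e ^ 3 + 108 * u * e ^ 2 * f + 108 * u * e * f ^ 2 + 36 * u * f ^ 3 + 4 * e ^ 4
        + 16 * e ^ 3 * f + 24 * e ^ 2 * f ^ 2 + 16 * e * f ^ 3 + 4 * f ^ 4) * w ^ 4) /
        (3 * u + e + f) ^ 4 := by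
    unfold nodalQuartic
    field_simp
    ring
  rw [key]
  positivity

set_option maxHeartbeats 1000000 in
theorem nodalQuartic_pos_of_ge {u v w t : ℝ} (hv : 0 < v) (hvu : v ≤ u) (hw : 0 < w) (ht : 0 ≤ t)
    (htv : t * (u + 2 * v) ≤ v) : 0 < nodalQuartic u v w t := by
  obtain ⟨e, he, rfl⟩ : ∃ e, 0 ≤ e ∧ u = v + e := ⟨u - v, by linarith, by ring⟩
  rcases ht.eq_or_lt with rfl | ht
  · have : nodalQuartic (v + e) v w 0 = 4 * (w + (v + e)) ^ 4 := by unfold nodalQuartic; ring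
    rw [this]; positivity
  obtain ⟨f, hf, rfl⟩ : ∃ f, 0 ≤ f ∧ t = v / (3 * v + e + f) := by
    refine ⟨v / t - (3 * v + e), ?_, by rw [add_sub_cancel, div_div_cancel₀ hv.ne']⟩
    rw [sub_nonneg, le_div_iff₀ ht]
    linarith
  have hd : 0 < 3 * v + e + f := by positivity
  have key : nodalQuartic (v + e) v w (v / (3 * v + e + f)) =
      ((144 * v ^ 6 * e ^ 2 + 144 * v ^ 6 * e * f + 36 * v ^ 6 * f ^ 2 + 480 * v ^ 5 * e ^ 3
        + 648 * v ^ 5 * e ^ 2 * f + 252 * v ^ 5 * e * f ^ 2 + 24 * v ^ 5 * f ^ 3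
        + 664 * v ^ 4 * e ^ 4 + 1172 * v ^ 4 * e ^ 3 * f + 645 * v ^ 4 * e ^ 2 * f ^ 2
        + 116 * v ^ 4 * e * f ^ 3 + 4 * v ^ 4 * f ^ 4 + 488 * v ^ 3 * e ^ 5
        + 1094 * v ^ 3 * e ^ 4 * f + 810 * v ^ 3 * e ^ 3 * f ^ 2 + 220 * v ^ 3 * e ^ 2 * f ^ 3
        + 16 * v ^ 3 * e * f ^ 4 + 201 * v ^ 2 * e ^ 6 + 558 * v ^ 2 * e ^ 5 * f
        + 537 * v ^ 2 * e ^ 4 * f ^ 2 + 204 * v ^ 2 * e ^ 3 * f ^ 3 + 24 * v ^ 2 * e ^ 2 * f ^ 4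
        + 44 * v * e ^ 7 + 148 * v * e ^ 6 * f + 180 * v * e ^ 5 * f ^ 2 + 92 * v * e ^ 4 * f ^ 3
        + 16 * v * e ^ 3 * f ^ 4 + 4 * e ^ 8 + 16 * e ^ 7 * f + 24 * e ^ 6 * f ^ 2
        + 16 * e ^ 5 * f ^ 3 + 4 * e ^ 4 * f ^ 4) + (432 * v ^ 6 * e + 216 * v ^ 6 * f
        + 1512 * v ^ 5 * e ^ 2 + 1440 * v ^ 5 * e * f + 288 * v ^ 5 * f ^ 2 + 2196 * v ^ 4 * e ^ 3
        + 3198 * v ^ 4 * e ^ 2 * f + 1272 * v ^ 4 * e * f ^ 2 + 120 * v ^ 4 * f ^ 3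
        + 1694 * v ^ 3 * e ^ 4 + 3410 * v ^ 3 * e ^ 3 * f + 2124 * v ^ 3 * e ^ 2 * f ^ 2
        + 424 * v ^ 3 * e * f ^ 3 + 16 * v ^ 3 * f ^ 4 + 732 * v ^ 2 * e ^ 5
        + 1920 * v ^ 2 * e ^ 4 * f + 1692 * v ^ 2 * e ^ 3 * f ^ 2 + 552 * v ^ 2 * e ^ 2 * f ^ 3
        + 48 * v ^ 2 * e * f ^ 4 + 168 * v * e ^ 6 + 552 * v * e ^ 5 * f + 648 * v * e ^ 4 * f ^ 2
        + 312 * v * e ^ 3 * f ^ 3 + 48 * v * e ^ 2 * f ^ 4 + 16 * e ^ 7 + 64 * e ^ 6 * f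
        + 96 * e ^ 5 * f ^ 2 + 64 * e ^ 4 * f ^ 3 + 16 * e ^ 3 * f ^ 4) * w + (324 * v ^ 6
        + 1404 * v ^ 5 * e + 756 * v ^ 5 * f + 2385 * v ^ 4 * e ^ 2 + 2682 * v ^ 4 * e * f
        + 612 * v ^ 4 * f ^ 2 + 2070 * v ^ 3 * e ^ 3 + 3648 * v ^ 3 * e ^ 2 * f
        + 1782 * v ^ 3 * e * f ^ 2 + 204 * v ^ 3 * f ^ 3 + 978 * v ^ 2 * e ^ 4
        + 2400 * v ^ 2 * e ^ 3 * f + 1890 * v ^ 2 * e ^ 2 * f ^ 2 + 492 * v ^ 2 * e * f ^ 3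
        + 24 * v ^ 2 * f ^ 4 + 240 * v * e ^ 5 + 768 * v * e ^ 4 * f + 864 * v * e ^ 3 * f ^ 2
        + 384 * v * e ^ 2 * f ^ 3 + 48 * v * e * f ^ 4 + 24 * e ^ 6 + 96 * e ^ 5 * f
        + 144 * e ^ 4 * f ^ 2 + 96 * e ^ 3 * f ^ 3 + 24 * e ^ 2 * f ^ 4) * w ^ 2 + (324 * v ^ 5
        + 918 * v ^ 4 * e + 648 * v ^ 4 * f + 1026 * v ^ 3 * e ^ 2 + 1494 * v ^ 3 * e * f
        + 468 * v ^ 3 * f ^ 2 + 564 * v ^ 2 * e ^ 3 + 1272 * v ^ 2 * e ^ 2 * f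
        + 852 * v ^ 2 * e * f ^ 2 + 144 * v ^ 2 * f ^ 3 + 152 * v * e ^ 4 + 472 * v * e ^ 3 * f
        + 504 * v * e ^ 2 * f ^ 2 + 200 * v * e * f ^ 3 + 16 * v * f ^ 4 + 16 * e ^ 5
        + 64 * e ^ 4 * f + 96 * e ^ 3 * f ^ 2 + 64 * e ^ 2 * f ^ 3 + 16 * e * f ^ 4) * w ^ 3
        + (81 * v ^ 4 + 162 * v ^ 3 * e + 162 * v ^ 3 * f + 117 * v ^ 2 * e ^ 2
        + 234 * v ^ 2 * e * f + 117 * v ^ 2 * f ^ 2 + 36 * v * e ^ 3 + 108 * v * e ^ 2 * f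
        + 108 * v * e * f ^ 2 + 36 * v * f ^ 3 + 4 * e ^ 4 + 16 * e ^ 3 * f + 24 * e ^ 2 * f ^ 2
        + 16 * e * f ^ 3 + 4 * f ^ 4) * w ^ 4) /
        (3 * v + e + f) ^ 4 := by
    unfold nodalQuartic
    field_simp
    ring
  rw [key]
  positivity

theorem nodalQuad_signs_of_le {u v w : ℝ} (hu : 0 < u) (huv : u ≤ v) (hw : 0 < w) :
    nodalQuadB u v w < 0 ∧
    nodalQuadB u v w + 2 * (u / (2 * u + v)) * nodalQuadA u v w < 0 ∧
    nodalQuadA u v w * (u / (2 * u + v)) ^ 2 + nodalQuadB u v w * (u / (2 * u + v)) +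
      nodalQuadC u v w ≤ 0 := by
  obtain ⟨e, he, rfl⟩ : ∃ e, 0 ≤ e ∧ v = u + e := ⟨v - u, by linarith, by ring⟩
  have hd : 0 < 2 * u + (u + e) := by positivity
  refine ⟨?_, ?_, ?_⟩
  · have key : nodalQuadB u (u + e) w =
        -(6 * u ^ 4 + 13 * u ^ 3 * e + 6 * u ^ 3 * w + 7 * u ^ 2 * e ^ 2 + 10 * u ^ 2 * e * w
          + 3 * u ^ 2 * w ^ 2 + u * e ^ 3 + 6 * u * e ^ 2 * w + 3 * u * e * w ^ 2 + 2 * e ^ 3 * w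
          + e ^ 2 * w ^ 2) := by
      unfold nodalQuadB; ring
    rw [key, neg_lt_zero]
    positivity
  · have key : nodalQuadB u (u + e) w + 2 * (u / (2 * u + (u + e))) * nodalQuadA u (u + e) w =
        -((18 * u ^ 5 + 33 * u ^ 4 * e + 18 * u ^ 4 * w + 24 * u ^ 3 * e ^ 2 + 24 * u ^ 3 * e * w
          + 9 * u ^ 3 * w ^ 2 + 8 * u ^ 2 * e ^ 3 + 16 * u ^ 2 * e ^ 2 * w
          + 12 * u ^ 2 * e * w ^ 2 + u * e ^ 4 + 8 * u * e ^ 3 * w + 6 * u * e ^ 2 * w ^ 2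
          + 2 * e ^ 4 * w + e ^ 3 * w ^ 2) /
          (2 * u + (u + e))) := by
      unfold nodalQuadB nodalQuadA
      field_simp
      ring
    rw [key, neg_lt_zero]
    positivity
  · have key : nodalQuadA u (u + e) w * (u / (2 * u + (u + e))) ^ 2 +
          nodalQuadB u (u + e) w * (u / (2 * u + (u + e))) + nodalQuadC u (u + e) w =
        -((36 * u ^ 5 * w + 78 * u ^ 4 * e * w + 18 * u ^ 4 * w ^ 2 + 66 * u ^ 3 * e ^ 2 * w
          + 27 * u ^ 3 * e * w ^ 2 + 26 * u ^ 2 * e ^ 3 * w + 13 * u ^ 2 * e ^ 2 * w ^ 2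
          + 4 * u * e ^ 4 * w + 2 * u * e ^ 3 * w ^ 2) /
          (2 * u + (u + e)) ^ 2) := by
      unfold nodalQuadB nodalQuadA nodalQuadC
      field_simp
      ring
    rw [key, neg_nonpos]
    positivity

theorem nodalQuad_signs_of_ge {u v w : ℝ} (hv : 0 < v) (hvu : v ≤ u) (hw : 0 < w)
    (h : u ^ 2 - u * v - u * w - 2 * v * w ≤ 0) :
    nodalQuadB u v w < 0 ∧
    nodalQuadB u v w + 2 * (v / (u + 2 * v)) * nodalQuadA u v w < 0 ∧
    nodalQuadA u v w * (v / (u + 2 * v)) ^ 2 + nodalQuadB u v w * (v / (u + 2 * v)) +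
      nodalQuadC u v w ≤ 0 := by
  obtain ⟨e, he, rfl⟩ : ∃ e, 0 ≤ e ∧ u = v + e := ⟨u - v, by linarith, by ring⟩
  have hd : 0 < 3 * v + e := by positivity
  have hd' : v + e + 2 * v = 3 * v + e := by ring
  obtain ⟨f, hf, rfl⟩ : ∃ f, 0 ≤ f ∧ w = (e * (v + e) + f) / (3 * v + e) := by
    refine ⟨w * (3 * v + e) - e * (v + e), by linarith, ?_⟩
    field_simp
    ring
  rw [hd']
  refine ⟨?_, ?_, ?_⟩
  · have key : nodalQuadB (v + e) v ((e * (v + e) + f) / (3 * v + e)) =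
        -((54 * v ^ 6 + 153 * v ^ 5 * e + 159 * v ^ 4 * e ^ 2 + 18 * v ^ 4 * f + 76 * v ^ 3 * e ^ 3
          + 36 * v ^ 3 * e * f + 17 * v ^ 2 * e ^ 4 + 32 * v ^ 2 * e ^ 2 * f + 3 * v ^ 2 * f ^ 2
          + v * e ^ 5 + 12 * v * e ^ 3 * f + 3 * v * e * f ^ 2 + 2 * e ^ 4 * f + e ^ 2 * f ^ 2) /
          (3 * v + e) ^ 2) := by
      unfold nodalQuadB
      field_simp
      ring
    rw [key, neg_lt_zero]
    positivity
  · have key : nodalQuadB (v + e) v ((e * (v + e) + f) / (3 * v + e)) +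
          2 * (v / (3 * v + e)) * nodalQuadA (v + e) v ((e * (v + e) + f) / (3 * v + e)) =
        -((162 * v ^ 7 + 621 * v ^ 6 * e + 972 * v ^ 5 * e ^ 2 + 54 * v ^ 5 * f
          + 801 * v ^ 4 * e ^ 3 + 162 * v ^ 4 * e * f + 369 * v ^ 3 * e ^ 4
          + 180 * v ^ 3 * e ^ 2 * f + 9 * v ^ 3 * f ^ 2 + 90 * v ^ 2 * e ^ 5
          + 92 * v ^ 2 * e ^ 3 * f + 12 * v ^ 2 * e * f ^ 2 + 9 * v * e ^ 6 + 22 * v * e ^ 4 * f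
          + 6 * v * e ^ 2 * f ^ 2 + 2 * e ^ 5 * f + e ^ 3 * f ^ 2) /
          (3 * v + e) ^ 3) := by
      unfold nodalQuadB nodalQuadA
      field_simp
      ring
    rw [key, neg_lt_zero]
    positivity
  · have key : nodalQuadA (v + e) v ((e * (v + e) + f) / (3 * v + e)) * (v / (3 * v + e)) ^ 2 +
          nodalQuadB (v + e) v ((e * (v + e) + f) / (3 * v + e)) * (v / (3 * v + e)) +
          nodalQuadC (v + e) v ((e * (v + e) + f) / (3 * v + e)) =
        -(f * (12 * v ^ 4 + 20 * v ^ 3 * e + 11 * v ^ 2 * e ^ 2 + 2 * v * e ^ 3 +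
            (6 * v ^ 3 + 7 * v ^ 2 * e + 2 * v * e ^ 2) * ((e * (v + e) + f) / (3 * v + e))) /
          (3 * v + e) ^ 2) := by
      unfold nodalQuadB nodalQuadA nodalQuadC
      field_simp
      ring
    rw [key, neg_nonpos]
    positivity

theorem existsUnique_quadratic_root {k₂ k₁ k₀ m : ℝ} (hm : 0 < m) (h₀ : 0 ≤ k₀) (h₁ : k₁ < 0)
    (h₂ : k₁ + 2 * m * k₂ < 0) (h₃ : k₂ * m ^ 2 + k₁ * m + k₀ ≤ 0) :
    ∃! t : ℝ, t ∈ Set.Icc 0 m ∧ k₂ * t ^ 2 + k₁ * t + k₀ = 0 := by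
  have hanti : ∀ s ∈ Set.Icc 0 m, ∀ t ∈ Set.Icc 0 m, s < t →
      k₂ * t ^ 2 + k₁ * t + k₀ < k₂ * s ^ 2 + k₁ * s + k₀ := by
    rintro s ⟨hs0, hsm⟩ t ⟨ht0, htm⟩ hst
    have hslope : k₁ + (s + t) * k₂ < 0 := by
      have h₄ : k₁ * (2 * m - (s + t)) < 0 := mul_neg_of_neg_of_pos h₁ (by linarith)
      have h₅ : (k₁ + 2 * m * k₂) * (s + t) ≤ 0 :=
        mul_nonpos_of_nonpos_of_nonneg h₂.le (by linarith)
      have h₆ : 2 * m * (k₁ + (s + t) * k₂) < 0 := by linarith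
      exact neg_of_mul_neg_right h₆ (by positivity)
    linarith [mul_neg_of_pos_of_neg (sub_pos.2 hst) hslope]
  obtain ⟨t, ht, hroot⟩ := intermediate_value_Icc' hm.le
    (f := fun t => k₂ * t ^ 2 + k₁ * t + k₀) (by fun_prop)
    (show (0 : ℝ) ∈ Set.Icc _ _ from ⟨h₃, by simpa using h₀⟩)
  refine ⟨t, ⟨ht, hroot⟩, ?_⟩
  rintro s ⟨hs, hsroot⟩
  have hroot' : k₂ * t ^ 2 + k₁ * t + k₀ = 0 := hroot
  rcases lt_trichotomy s t with hlt | heq | hlt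
  · linarith [hanti s hs t ht hlt]
  · exact heq
  · linarith [hanti t ht s hs hlt]


/-- Under the conditions `2b⁴ + 2c⁴ − a²b² − a²c² − 2b²c² ≤ 0` and
`1/a² + 1/c² ≥ 3/b²`, there is exactly one parameter `t₀` in
`[0, min((b²−c²)/(a²+b²−2c²), (a²−b²)/(2a²−b²−c²))]` at which the nodal curve of
the caustic (Cayley's parametrization) meets the ellipsoid, and this `t₀` is a
root of the quadratic `p`. -/
theorem stmt_17 (a b c : ℝ) (hab : a > b) (hbc : b > c) (hc : c > 0)
    (h1 : 2 * b ^ 4 + 2 * c ^ 4 - a ^ 2 * b ^ 2 - a ^ 2 * c ^ 2 - 2 * b ^ 2 * c ^ 2 ≤ 0)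
    (h2 : 1 / a ^ 2 + 1 / c ^ 2 ≥ 3 / b ^ 2)
    (α β γ Ω m : ℝ)
    (hα : α = b ^ 2 - c ^ 2) (hβ : β = c ^ 2 - a ^ 2) (hγ : γ = a ^ 2 - b ^ 2)
    (hΩ : Ω = α ^ 2 - β * γ)
    (hm : m = min ((b ^ 2 - c ^ 2) / (a ^ 2 + b ^ 2 - 2 * c ^ 2))
      ((a ^ 2 - b ^ 2) / (2 * a ^ 2 - b ^ 2 - c ^ 2)))
    (X Y Z p : ℝ → ℝ)
    (hX : ∀ t, X t = ((γ - α) * t + α) * ((γ - α) * t - 2 * γ) ^ 2 *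
      ((β - γ) * t + γ) ^ 3 / (-β * γ * a ^ 2 * (α * γ + Ω * t) * (3 * t - 2) ^ 2))
    (hY : ∀ t, Y t = t ^ 2 * (t - 1) * ((γ - α) ^ 2 * t + 3 * α * γ) ^ 3 /
      (-α * γ * b ^ 2 * (α * γ + Ω * t) * (3 * t - 2) ^ 2))
    (hZ : ∀ t, Z t = ((γ - α) * t - γ) * ((γ - α) * t + 2 * α) ^ 2 *
      ((α - β) * t - α) ^ 3 / (-α * β * c ^ 2 * (α * γ + Ω * t) * (3 * t - 2) ^ 2))
    (hp : ∀ t, p t =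
      (a ^ 4 * b ^ 2 + a ^ 4 * c ^ 2 + a ^ 2 * b ^ 4 + a ^ 2 * c ^ 4 + b ^ 4 * c ^ 2 +
          b ^ 2 * c ^ 4 - 6 * a ^ 2 * b ^ 2 * c ^ 2) *
        (a ^ 2 - 2 * b ^ 2 + c ^ 2) * t ^ 2 +
      (11 * a ^ 4 * b ^ 2 * c ^ 2 + 11 * a ^ 2 * b ^ 2 * c ^ 4 + 3 * a ^ 2 * b ^ 6 +
          3 * b ^ 6 * c ^ 2 - a ^ 6 * b ^ 2 - a ^ 6 * c ^ 2 - a ^ 2 * c ^ 6 -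
          b ^ 2 * c ^ 6 - a ^ 4 * b ^ 4 - 5 * a ^ 4 * c ^ 4 - b ^ 4 * c ^ 4 -
          17 * a ^ 2 * b ^ 4 * c ^ 2) * t +
      (a ^ 2 - b ^ 2) * (b ^ 2 - c ^ 2) *
        (a ^ 2 * b ^ 2 + b ^ 2 * c ^ 2 - 3 * a ^ 2 * c ^ 2)) :
    (∃! t₀ : ℝ, t₀ ∈ Set.Icc (0 : ℝ) m ∧
      X t₀ / a ^ 2 + Y t₀ / b ^ 2 + Z t₀ / c ^ 2 = 1) ∧
    (∀ t₀ ∈ Set.Icc (0 : ℝ) m,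
      X t₀ / a ^ 2 + Y t₀ / b ^ 2 + Z t₀ / c ^ 2 = 1 → p t₀ = 0) := by
  subst hα hβ hγ hΩ
  obtain ⟨u, hu⟩ : ∃ u, u = b ^ 2 - c ^ 2 := ⟨_, rfl⟩
  obtain ⟨v, hv⟩ : ∃ v, v = a ^ 2 - b ^ 2 := ⟨_, rfl⟩
  obtain ⟨w, hw⟩ : ∃ w, w = c ^ 2 := ⟨_, rfl⟩
  have hu0 : 0 < u := by rw [hu]; nlinarith
  have hv0 : 0 < v := by rw [hv]; nlinarith
  have hw0 : 0 < w := by rw [hw]; positivity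
  have ha2 : a ^ 2 = w + u + v := by rw [hu, hv, hw]; ring
  have hb2 : b ^ 2 = w + u := by rw [hu, hw]; ring
  have hneg : c ^ 2 - a ^ 2 = -(u + v) := by rw [hu, hv]; ring
  have hm' : m = min (u / (2 * u + v)) (v / (u + 2 * v)) := by
    rw [hm, hu, hv]
    congr 2 <;> ring
  have hp' : ∀ t, p t = nodalQuadA u v w * t ^ 2 + nodalQuadB u v w * t + nodalQuadC u v w := by
    intro t
    rw [hp, hu, hv, hw]
    unfold nodalQuadA nodalQuadB nodalQuadC
    ring
  have hm0 : 0 < m := by rw [hm']; positivity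
  have hbound : ∀ t ∈ Set.Icc 0 m, t * (2 * u + v) ≤ u ∧ t * (u + 2 * v) ≤ v := by
    rintro t ⟨-, ht⟩
    rw [hm', le_min_iff, le_div_iff₀ (by positivity), le_div_iff₀ (by positivity)] at ht
    exact ht
  have hfactor : ∀ t ∈ Set.Icc 0 m,
      X t / a ^ 2 + Y t / b ^ 2 + Z t / c ^ 2 - 1 = p t * nodalQuartic u v w t /
        (((w + u + v) * (w + u) * w) ^ 2 *
          ((u * v + (u ^ 2 - -(u + v) * v) * t) * (3 * t - 2) ^ 2)) := by
    intro t ht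
    have ht0 : 0 ≤ t := ht.1
    rw [hX, hY, hZ, hp', hneg, ← hu, ← hv, ← hw, ha2, hb2]
    refine div_sum_sub_one (by positivity) (by positivity) hw0.ne' hu0.ne' hv0.ne'
      (by positivity) ?_ ?_ (nodal_numerator_factor u v w t)
    · rw [neg_mul, sub_neg_eq_add]
      positivity
    · have := hbound t ht
      nlinarith
  have hquartic : ∀ t ∈ Set.Icc 0 m, 0 < nodalQuartic u v w t := by
    intro t ht
    rcases le_total u v with huv | hvu
    · exact nodalQuartic_pos_of_le hu0 huv hw0 ht.1 (hbound t ht).1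
    · exact nodalQuartic_pos_of_ge hv0 hvu hw0 ht.1 (hbound t ht).2
  have hiff : ∀ t ∈ Set.Icc 0 m, X t / a ^ 2 + Y t / b ^ 2 + Z t / c ^ 2 = 1 ↔ p t = 0 := by
    intro t ht
    have ht0 : 0 ≤ t := ht.1
    have hd : (u * v + (u ^ 2 - -(u + v) * v) * t) ≠ 0 := by
      rw [neg_mul, sub_neg_eq_add]
      positivity
    have hk : 3 * t - 2 ≠ 0 := by
      have := hbound t ht
      nlinarith
    have hden : ((w + u + v) * (w + u) * w) ^ 2 *
        ((u * v + (u ^ 2 - -(u + v) * v) * t) * (3 * t - 2) ^ 2) ≠ 0 := by positivity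
    rw [← sub_eq_zero, hfactor t ht, div_eq_zero_iff, or_iff_left hden, mul_eq_zero,
      or_iff_left (hquartic t ht).ne']
  have hC : 0 ≤ nodalQuadC u v w := by
    unfold nodalQuadC
    rw [ge_iff_le, ← hw, ha2, hb2, div_add_div _ _ (by positivity) (by positivity),
      div_le_div_iff₀ (by positivity) (by positivity)] at h2
    refine mul_nonneg (by positivity) ?_
    linarith
  have hsigns : nodalQuadB u v w < 0 ∧ nodalQuadB u v w + 2 * m * nodalQuadA u v w < 0 ∧
      nodalQuadA u v w * m ^ 2 + nodalQuadB u v w * m + nodalQuadC u v w ≤ 0 := by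
    rcases le_total u v with huv | hvu
    · have hmu : m = u / (2 * u + v) := by
        rw [hm', min_eq_left]
        rw [div_le_div_iff₀ (by positivity) (by positivity)]
        nlinarith
      rw [hmu]
      exact nodalQuad_signs_of_le hu0 huv hw0
    · have hmv : m = v / (u + 2 * v) := by
        rw [hm', min_eq_right]
        rw [div_le_div_iff₀ (by positivity) (by positivity)]
        nlinarith
      rw [hmv]
      refine nodalQuad_signs_of_ge hv0 hvu hw0 ?_
      rw [hu, hv, hw]
      linarith
  refine ⟨?_, fun t ht h => (hiff t ht).1 h⟩
  obtain ⟨t, ⟨ht, hroot⟩, huniq⟩ :=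
    existsUnique_quadratic_root hm0 hC hsigns.1 hsigns.2.1 hsigns.2.2
  refine ⟨t, ⟨ht, (hiff t ht).2 ((hp' t).trans hroot)⟩, ?_⟩
  rintro s ⟨hs, hs1⟩
  exact huniq s ⟨hs, (hp' s).symm.trans ((hiff s hs).1 hs1)⟩
end

section
/- Let a > b > c > 0 and let A = (X,Y,Z) ∈ ℝ³ with X ≠ 0, Y ≠ 0, Z ≠ 0. Let S = {(x,y,z) ∈ ℝ³ : x²/a² + y²/b² + z²/c² = 1 and there exists s ∈ ℝ with (X−x, Y−y, Z−z) = s·(x/a², y/b², z/c²)} be the set of feet of normals of the ellipsoid passing through A. Then S is finite and 2 ≤ |S| ≤ 6. -/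
/-- The equation `u / (s - α)² + v / (s - β)² + w / (s - γ)² = 1` has a solution to the right of
its largest pole `γ`. -/
theorem exists_gt_sum_div_sub_sq_eq_one {α β γ u v w : ℝ} (hα : α < γ) (hβ : β < γ)
    (hu : 0 < u) (hv : 0 < v) (hw : 0 < w) :
    ∃ s, γ < s ∧ u / (s - α) ^ 2 + v / (s - β) ^ 2 + w / (s - γ) ^ 2 = 1 := by
  have hsq : 0 < √w := Real.sqrt_pos.2 hw
  have hww : √w ^ 2 = w := Real.sq_sqrt hw.le
  have hle : γ + √w ≤ γ + (u + v + w + 1) := by nlinarith [sq_nonneg (√w - 1)]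
  have hcont : ContinuousOn (fun s => u / (s - α) ^ 2 + v / (s - β) ^ 2 + w / (s - γ) ^ 2)
      (Set.Icc (γ + √w) (γ + (u + v + w + 1))) := by
    have aux : ∀ t δ : ℝ, δ ≤ γ → ContinuousOn (fun s => t / (s - δ) ^ 2)
        (Set.Icc (γ + √w) (γ + (u + v + w + 1))) := fun t δ hδ =>
      continuousOn_const.div (by fun_prop) fun s hs => pow_ne_zero 2 (by linarith [hs.1])
    exact ((aux u α hα.le).add (aux v β hβ.le)).add (aux w γ le_rfl)
  have hleft : 1 ≤ u / (γ + √w - α) ^ 2 + v / (γ + √w - β) ^ 2 + w / (γ + √w - γ) ^ 2 := by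
    have h1 : w / (γ + √w - γ) ^ 2 = 1 := by
      rw [add_sub_cancel_left, hww, div_self hw.ne']
    have h2 : 0 ≤ u / (γ + √w - α) ^ 2 := by positivity
    have h3 : 0 ≤ v / (γ + √w - β) ^ 2 := by positivity
    linarith
  have hright : u / (γ + (u + v + w + 1) - α) ^ 2 + v / (γ + (u + v + w + 1) - β) ^ 2 +
      w / (γ + (u + v + w + 1) - γ) ^ 2 ≤ 1 := by
    have aux : ∀ t δ : ℝ, 0 < t → δ ≤ γ →
        t / (γ + (u + v + w + 1) - δ) ^ 2 ≤ t / (u + v + w + 1) ^ 2 := fun t δ ht hδ => by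
      gcongr
      linarith
    have h : u / (u + v + w + 1) ^ 2 + v / (u + v + w + 1) ^ 2 + w / (u + v + w + 1) ^ 2 ≤ 1 := by
      rw [← add_div, ← add_div, div_le_one (by positivity)]
      nlinarith [add_pos (add_pos hu hv) hw]
    linarith [aux u α hu hα.le, aux v β hv hβ.le, aux w γ hw le_rfl]
  obtain ⟨s, hs, h⟩ := intermediate_value_Icc' hle hcont ⟨hright, hleft⟩
  exact ⟨s, by linarith [hs.1], h⟩

open Polynomial in
/-- The equation `u / (p + s)² + v / (q + s)² + w / (r + s)² = 1` has at most six solutions away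
from its poles. -/
theorem exists_finset_card_le_six_of_sum_div_add_sq_eq_one (p q r u v w : ℝ) :
    ∃ T : Finset ℝ, T.card ≤ 6 ∧ ∀ s, p + s ≠ 0 → q + s ≠ 0 → r + s ≠ 0 →
      u / (p + s) ^ 2 + v / (q + s) ^ 2 + w / (r + s) ^ 2 = 1 → s ∈ T := by
  classical
  let L : ℝ[X] := C u * (X + C q) ^ 2 * (X + C r) ^ 2 + C v * (X + C p) ^ 2 * (X + C r) ^ 2 +
    C w * (X + C p) ^ 2 * (X + C q) ^ 2
  let M : ℝ[X] := (X + C p) ^ 2 * (X + C q) ^ 2 * (X + C r) ^ 2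
  have hL : L.natDegree ≤ 4 := by
    simp only [L]
    compute_degree
  have hMm : M.Monic :=
    (((monic_X_add_C p).pow 2).mul ((monic_X_add_C q).pow 2)).mul ((monic_X_add_C r).pow 2)
  have hM : M.natDegree = 6 := by
    simp only [M]
    compute_degree!
  have hdeg : (M - L).natDegree = 6 := by
    rw [natDegree_sub_eq_left_of_natDegree_lt (by omega), hM]
  have hne : M - L ≠ 0 := by
    intro h
    simp [h] at hdeg
  refine ⟨(M - L).roots.toFinset, (Multiset.toFinset_card_le _).trans
    ((card_roots' _).trans hdeg.le), fun s hp hq hr h => ?_⟩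
  rw [Multiset.mem_toFinset, mem_roots hne, IsRoot.def]
  simp only [M, L, eval_sub, eval_add, eval_mul, eval_pow, eval_X, eval_C]
  field_simp at h
  linear_combination -h

/-- The point with parameter `s` on the curve of points `B` for which `A - B` is parallel to
`(x / a², y / b², z / c²)`, where `A = (X, Y, Z)`. -/
noncomputable def normalFoot (a b c X Y Z s : ℝ) : ℝ × ℝ × ℝ :=
  (a ^ 2 * X / (a ^ 2 + s), b ^ 2 * Y / (b ^ 2 + s), c ^ 2 * Z / (c ^ 2 + s))

theorem sub_eq_mul_div_sq_iff {a X x s : ℝ} (ha : 0 < a) (hX : X ≠ 0) :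
    X - x = s * (x / a ^ 2) ↔ a ^ 2 + s ≠ 0 ∧ x = a ^ 2 * X / (a ^ 2 + s) := by
  have hmul : X - x = s * (x / a ^ 2) ↔ x * (a ^ 2 + s) = a ^ 2 * X := by
    field_simp
    constructor <;> intro h <;> linear_combination -h
  rw [hmul]
  constructor
  · intro h
    have h0 : a ^ 2 + s ≠ 0 := by
      intro h0
      rw [h0, mul_zero] at h
      exact mul_ne_zero (pow_ne_zero 2 ha.ne') hX h.symm
    exact ⟨h0, by rw [eq_div_iff h0, h]⟩
  · rintro ⟨h0, rfl⟩
    exact div_mul_cancel₀ _ h0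

theorem normalFoot_coord_sq_div {a X s : ℝ} (ha : 0 < a) :
    (a ^ 2 * X / (a ^ 2 + s)) ^ 2 / a ^ 2 = a ^ 2 * X ^ 2 / (a ^ 2 + s) ^ 2 := by
  rw [div_pow, div_right_comm]
  congr 1
  field_simp

/-- For a point `A = (X, Y, Z)` with all coordinates nonzero, the set of feet of
normals of the ellipsoid `x²/a² + y²/b² + z²/c² = 1` passing through `A` is finite
and has between 2 and 6 elements. -/
theorem stmt_18 (a b c : ℝ) (hab : a > b) (hbc : b > c) (hc : c > 0)
    (X Y Z : ℝ) (hX : X ≠ 0) (hY : Y ≠ 0) (hZ : Z ≠ 0)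
    (S : Set (ℝ × ℝ × ℝ))
    (hS : S = {B : ℝ × ℝ × ℝ |
      B.1 ^ 2 / a ^ 2 + B.2.1 ^ 2 / b ^ 2 + B.2.2 ^ 2 / c ^ 2 = 1 ∧
      ∃ s : ℝ, (X - B.1, Y - B.2.1, Z - B.2.2) =
        s • (B.1 / a ^ 2, B.2.1 / b ^ 2, B.2.2 / c ^ 2)}) :
    S.Finite ∧ 2 ≤ S.ncard ∧ S.ncard ≤ 6 := by
  have hb : 0 < b := hc.trans hbc
  have ha : 0 < a := hb.trans hab
  have hab2 : b ^ 2 < a ^ 2 := by gcongr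
  have hbc2 : c ^ 2 < b ^ 2 := by gcongr
  have hu : 0 < a ^ 2 * X ^ 2 := by positivity
  have hv : 0 < b ^ 2 * Y ^ 2 := by positivity
  have hw : 0 < c ^ 2 * Z ^ 2 := by positivity
  have hmem : ∀ B, B ∈ S ↔ ∃ s, (a ^ 2 + s ≠ 0 ∧ b ^ 2 + s ≠ 0 ∧ c ^ 2 + s ≠ 0) ∧
      a ^ 2 * X ^ 2 / (a ^ 2 + s) ^ 2 + b ^ 2 * Y ^ 2 / (b ^ 2 + s) ^ 2 +
        c ^ 2 * Z ^ 2 / (c ^ 2 + s) ^ 2 = 1 ∧ normalFoot a b c X Y Z s = B := by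
    rintro ⟨x, y, z⟩
    simp only [hS, Set.mem_ofPred_eq, Prod.smul_mk, smul_eq_mul, Prod.mk.injEq, normalFoot,
      sub_eq_mul_div_sq_iff ha hX, sub_eq_mul_div_sq_iff hb hY, sub_eq_mul_div_sq_iff hc hZ]
    constructor
    · rintro ⟨h, s, ⟨h1, rfl⟩, ⟨h2, rfl⟩, h3, rfl⟩
      rw [normalFoot_coord_sq_div ha, normalFoot_coord_sq_div hb, normalFoot_coord_sq_div hc] at h
      exact ⟨s, ⟨h1, h2, h3⟩, h, rfl, rfl, rfl⟩
    · rintro ⟨s, ⟨h1, h2, h3⟩, h, rfl, rfl, rfl⟩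
      rw [normalFoot_coord_sq_div ha, normalFoot_coord_sq_div hb, normalFoot_coord_sq_div hc]
      exact ⟨h, s, ⟨h1, rfl⟩, ⟨h2, rfl⟩, h3, rfl⟩
  obtain ⟨T, hT6, hT⟩ := exists_finset_card_le_six_of_sum_div_add_sq_eq_one
    (a ^ 2) (b ^ 2) (c ^ 2) (a ^ 2 * X ^ 2) (b ^ 2 * Y ^ 2) (c ^ 2 * Z ^ 2)
  have hsub : S ⊆ normalFoot a b c X Y Z '' (T : Set ℝ) := by
    intro B hB
    obtain ⟨s, ⟨h1, h2, h3⟩, h, rfl⟩ := (hmem B).1 hB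
    exact ⟨s, hT s h1 h2 h3 h, rfl⟩
  have himage : (normalFoot a b c X Y Z '' (T : Set ℝ)).Finite := T.finite_toSet.image _
  have hfin : S.Finite := himage.subset hsub
  refine ⟨hfin, ?_, ?_⟩
  · obtain ⟨s, hs, h⟩ := exists_gt_sum_div_sub_sq_eq_one (α := -a ^ 2) (β := -b ^ 2)
      (γ := -c ^ 2) (by linarith) (by linarith) hu hv hw
    obtain ⟨t, ht, h'⟩ := exists_gt_sum_div_sub_sq_eq_one (α := c ^ 2) (β := b ^ 2)
      (γ := a ^ 2) (by linarith) hab2 hw hv hu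
    have hsS : normalFoot a b c X Y Z s ∈ S :=
      (hmem _).2 ⟨s, ⟨by linarith, by linarith, by linarith⟩, by
        rw [← h]; congr 3 <;> ring, rfl⟩
    have htS : normalFoot a b c X Y Z (-t) ∈ S :=
      (hmem _).2 ⟨-t, ⟨by linarith, by linarith, by linarith⟩, by
        rw [← h', sub_sq_comm, sub_sq_comm t, sub_sq_comm t]; ring, rfl⟩
    have hne : normalFoot a b c X Y Z s ≠ normalFoot a b c X Y Z (-t) := by
      intro heq
      have hfst : a ^ 2 * X / (a ^ 2 + s) = a ^ 2 * X / (a ^ 2 + -t) := congrArg Prod.fst heq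
      rw [div_eq_div_iff (by linarith) (by linarith)] at hfst
      have := mul_left_cancel₀ (mul_ne_zero (pow_ne_zero 2 ha.ne') hX) hfst
      linarith
    exact (Set.one_lt_ncard hfin).2 ⟨_, hsS, _, htS, hne⟩
  · calc S.ncard ≤ (normalFoot a b c X Y Z '' (T : Set ℝ)).ncard := Set.ncard_le_ncard hsub himage
      _ ≤ (T : Set ℝ).ncard := Set.ncard_image_le T.finite_toSet
      _ ≤ 6 := by rwa [Set.ncard_coe_finset]
end

section
/- Let a > b > 0 and let X, Y ∈ ℝ with X ≠ 0 and Y ≠ 0. Suppose there exists t ∈ ℝ with t ≠ −a², t ≠ −b², (aX/(a²+t))² + (bY/(b²+t))² = 1, and a²X²/(a²+t)³ + b²Y²/(b²+t)³ = 0. Then (X,Y) lies on the astroid: (a²X²)^(1/3) + (b²Y²)^(1/3) = ((a²−b²)²)^(1/3). -/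
/-- Eliminating the parameter `t` from the planar specialization of the caustic
equations yields the astroid: if `(aX/(a²+t))² + (bY/(b²+t))² = 1` and
`a²X²/(a²+t)³ + b²Y²/(b²+t)³ = 0` for some admissible `t`, then
`(a²X²)^(1/3) + (b²Y²)^(1/3) = ((a²−b²)²)^(1/3)`. -/
theorem stmt_19 (a b : ℝ) (hab : a > b) (hb : b > 0) (X Y : ℝ)
    (hX : X ≠ 0) (hY : Y ≠ 0)
    (h : ∃ t : ℝ, t ≠ -a ^ 2 ∧ t ≠ -b ^ 2 ∧
      (a * X / (a ^ 2 + t)) ^ 2 + (b * Y / (b ^ 2 + t)) ^ 2 = 1 ∧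
      a ^ 2 * X ^ 2 / (a ^ 2 + t) ^ 3 + b ^ 2 * Y ^ 2 / (b ^ 2 + t) ^ 3 = 0) :
    (a ^ 2 * X ^ 2) ^ ((1 : ℝ) / 3) + (b ^ 2 * Y ^ 2) ^ ((1 : ℝ) / 3)
      = ((a ^ 2 - b ^ 2) ^ 2) ^ ((1 : ℝ) / 3) := by
  obtain ⟨t, htp, htq, h1, h2⟩ := h
  have ha : 0 < a := hb.trans hab
  have hp : a ^ 2 + t ≠ 0 := fun h => htp (by linarith)
  have hq : b ^ 2 + t ≠ 0 := fun h => htq (by linarith)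
  have hc : 0 < a ^ 2 - b ^ 2 := by nlinarith
  obtain ⟨p, hpdef⟩ : ∃ p, p = a ^ 2 + t := ⟨_, rfl⟩
  obtain ⟨q, hqdef⟩ : ∃ q, q = b ^ 2 + t := ⟨_, rfl⟩
  have hpq : a ^ 2 - b ^ 2 = p - q := by rw [hpdef, hqdef]; ring
  rw [← hpdef] at h1 h2 hp
  rw [← hqdef] at h1 h2 hq
  rw [div_pow, div_pow, mul_pow, mul_pow] at h1
  have hA : 0 < a ^ 2 * X ^ 2 := by positivity
  have hB : 0 < b ^ 2 * Y ^ 2 := by positivity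
  rw [hpq] at hc ⊢
  generalize a ^ 2 * X ^ 2 = A at *
  generalize b ^ 2 * Y ^ 2 = B at *
  rw [div_add_div _ _ (by positivity) (by positivity), div_eq_iff (by positivity)] at h1
  rw [div_add_div _ _ (by positivity) (by positivity), div_eq_zero_iff,
    or_iff_left (by positivity)] at h2
  have hAp : A * (p - q) = p ^ 3 := by
    apply mul_right_cancel₀ (pow_ne_zero 2 hq)
    linear_combination p * h1 - h2
  have hBq : B * (p - q) = (-q) ^ 3 := by
    apply mul_right_cancel₀ (pow_ne_zero 2 hp)
    linear_combination h2 - q * h1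
  have hp0 : 0 < p := (Odd.pow_pos_iff (by decide : Odd 3)).1 (hAp ▸ mul_pos hA hc)
  have hq0 : 0 < -q := (Odd.pow_pos_iff (by decide : Odd 3)).1 (hBq ▸ mul_pos hB hc)
  have cbrt_cube (x : ℝ) (hx : 0 ≤ x) : (x ^ 3) ^ ((1 : ℝ) / 3) = x := by
    rw [one_div]
    exact_mod_cast Real.pow_rpow_inv_natCast hx three_ne_zero
  obtain ⟨r, hr, hrc⟩ : ∃ r : ℝ, 0 < r ∧ r ^ 3 = p - q :=
    ⟨(p - q) ^ ((3 : ℕ) : ℝ)⁻¹, by positivity,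
      Real.rpow_inv_natCast_pow hc.le three_ne_zero⟩
  have hA3 : A = (p / r) ^ 3 := by
    rw [div_pow, hrc, eq_div_iff hc.ne', hAp]
  have hB3 : B = (-q / r) ^ 3 := by
    rw [div_pow, hrc, eq_div_iff hc.ne', hBq]
  have hC3 : (p - q) ^ 2 = (r ^ 2) ^ 3 := by rw [← hrc]; ring
  rw [hA3, hB3, hC3, cbrt_cube _ (by positivity), cbrt_cube _ (by positivity),
    cbrt_cube _ (by positivity), ← add_div, div_eq_iff hr.ne']
  linear_combination -hrc
end
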